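/- The space CF is a classifying space for Thompson's group F; that is, CF is path-connected, the fundamental group of CF is isomorphic to Thompson's group F, and the homotopy groups π_k(CF) are trivial for every k ≥ 2. -/

import Mathlib

/-- The set `CF_n ⊆ ℝ^n`: nondecreasing tuples with `t_{i+2} - t_i ≥ 1`. -/
def CFset (n : ℕ) : Set (Fin n → ℝ) :=
  {t | Monotone t ∧ ∀ (i : ℕ) (h : i + 2 < n), 1 ≤ t ⟨i + 2, h⟩ - t ⟨i, by omega⟩}

/-- `CF_n` as a topological space (subspace of `ℝ^n`). -/
abbrev CFn (n : ℕ) := ↥(CFset n)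

/-- The disjoint union `⨿_{n ≥ 1} CF_n`. -/
abbrev PreCF := (n : ℕ) × CFn (n + 1)

/-- Duplication of the `i`-th entry of a tuple. -/
def dup {n : ℕ} (t : Fin (n + 1) → ℝ) (i : Fin (n + 1)) : Fin (n + 2) → ℝ :=
  Fin.insertNth i.castSucc (t i) t

/-- The identification: a tuple is related to the result of duplicating one of its
entries, whenever the duplicated tuple still lies in the relevant `CF_{n+1}`. -/
def CFrel : PreCF → PreCF → Prop := fun x y =>
  ∃ (i : Fin (x.1 + 1)) (h : dup (x.2 : Fin (x.1 + 1) → ℝ) i ∈ CFset (x.1 + 2)),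
    y = ⟨x.1 + 1, ⟨dup (x.2 : Fin (x.1 + 1) → ℝ) i, h⟩⟩

/-- Belk's space `CF`: the quotient of `⨿ CF_n` by the identifications. -/
abbrev CF := Quot CFrel

/-- A basepoint of `CF`: the one-point configuration `(1)`. -/
def CFbase : CF :=
  Quot.mk CFrel ⟨0, ⟨fun _ => 1, ⟨monotone_const, fun i h => absurd h (by omega)⟩⟩⟩

/-- The unit interval `[0,1]` as a topological space. -/
abbrev unitI := ↥(Set.Icc (0 : ℝ) 1)

/-- The group of self-homeomorphisms of `[0,1]`, with composition as multiplication. -/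
instance homeoGroup : Group (unitI ≃ₜ unitI) where
  mul f g := g.trans f
  one := Homeomorph.refl _
  inv := Homeomorph.symm
  mul_assoc a b c := Homeomorph.ext fun _ => rfl
  one_mul a := Homeomorph.ext fun _ => rfl
  mul_one a := Homeomorph.ext fun _ => rfl
  inv_mul_cancel a := Homeomorph.ext fun x => a.symm_apply_apply x

/-- A dyadic rational: a real of the form `a / 2 ^ b` with `a b : ℕ`. -/
def IsDyadic (x : ℝ) : Prop := ∃ a b : ℕ, x = (a : ℝ) / 2 ^ b

/-- A homeomorphism of `[0,1]` lies in Thompson's group `F` iff it is piecewise linear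
with finitely many breakpoints, all at dyadic rationals, and all slopes powers of `2`:
there is a partition `0 = x₀ < x₁ < ⋯ < x_k = 1` by dyadic rationals such that on each
`[x_{j-1}, x_j]` the map is affine with slope `2^m`, `m : ℤ`. -/
def IsThompsonF (f : unitI ≃ₜ unitI) : Prop :=
  ∃ (k : ℕ) (x : Fin (k + 1) → ℝ), x 0 = 0 ∧ x (Fin.last k) = 1 ∧ StrictMono x ∧
    (∀ j, IsDyadic (x j)) ∧
    ∀ j : Fin k, ∃ (m : ℤ) (c : ℝ), ∀ y : unitI,
      x j.castSucc ≤ (y : ℝ) → (y : ℝ) ≤ x j.succ → ((f y : ℝ)) = 2 ^ m * (y : ℝ) + c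

section

/-- Orientation preserving homeomorphisms of the line. -/
abbrev OI := ℝ ≃o ℝ

/-- `f` maps each standard dyadic interval of level `M` linearly onto a standard dyadic
interval of level at least `r`. -/
def StdAtK (M r : ℕ) (f : OI) : Prop :=
  ∀ a : ℤ, ∃ b : ℤ, ∃ k : ℕ, r ≤ k ∧
    ∀ y : ℝ, 0 ≤ y → y ≤ 1 → f ((a + y) / 2 ^ M) = (b + y) / 2 ^ k

/-- `f` maps each standard dyadic interval of level `M` linearly onto a standard one. -/
def StdAt (M : ℕ) (f : OI) : Prop := StdAtK M 0 f

/-- `f` is standard at some level. -/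
def Std (f : OI) : Prop := ∃ M, StdAt M f

theorem StdAtK.succ {M r : ℕ} {f : OI} (h : StdAtK M r f) : StdAtK (M + 1) (r + 1) f := by
  intro a
  obtain ⟨b, k, hk, hb⟩ := h (a / 2)
  refine ⟨2 * b + a % 2, k + 1, by omega, fun y hy0 hy1 => ?_⟩
  have h1 : 0 ≤ a % 2 := Int.emod_nonneg _ (by norm_num)
  have h2 : a % 2 ≤ 1 := by omega
  have h1' : (0 : ℝ) ≤ ((a % 2 : ℤ) : ℝ) := by exact_mod_cast h1
  have h2' : ((a % 2 : ℤ) : ℝ) ≤ 1 := by exact_mod_cast h2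
  have h3 : (a : ℝ) = 2 * ((a / 2 : ℤ) : ℝ) + ((a % 2 : ℤ) : ℝ) := by
    exact_mod_cast (Int.mul_ediv_add_emod a 2).symm
  have := hb ((((a % 2 : ℤ) : ℝ) + y) / 2) (by positivity) (by linarith)
  have e1 : ((a : ℝ) + y) / 2 ^ (M + 1)
      = (((a / 2 : ℤ) : ℝ) + (((a % 2 : ℤ) : ℝ) + y) / 2) / 2 ^ M := by
    rw [h3, pow_succ]; field_simp; ring
  rw [e1, this]
  push_cast
  rw [pow_succ]; field_simp; ring

theorem StdAtK.mono {M r s : ℕ} {f : OI} (h : StdAtK M r f) (hs : s ≤ r) : StdAtK M s f := by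
  intro a
  obtain ⟨b, k, hk, hb⟩ := h a
  exact ⟨b, k, by omega, hb⟩

theorem StdAtK.add {M r : ℕ} {f : OI} (h : StdAtK M r f) (d : ℕ) :
    StdAtK (M + d) (r + d) f := by
  induction d with
  | zero => exact h
  | succ d ih => exact ih.succ

theorem StdAt.mono {M M' : ℕ} {f : OI} (h : StdAt M f) (hM : M ≤ M') : StdAt M' f := by
  obtain ⟨d, rfl⟩ := Nat.exists_eq_add_of_le hM
  exact (StdAtK.add h d).mono (Nat.zero_le _)

theorem StdAtK.comp {M M' : ℕ} {f g : OI} (hf : StdAtK M M' f) (hg : StdAt M' g) :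
    StdAt M (g * f) := by
  intro a
  obtain ⟨b, k, hk, hb⟩ := hf a
  obtain ⟨c, l, -, hl⟩ := (hg.mono hk) b
  exact ⟨c, l, Nat.zero_le _, fun y h0 h1 => by rw [RelIso.mul_apply, hb y h0 h1, hl y h0 h1]⟩

theorem StdAt.comp {M M' : ℕ} {f g : OI} (hf : StdAt M f) (hg : StdAt M' g) :
    StdAt (M + M') (g * f) :=
  StdAtK.comp ((StdAtK.add hf M').mono (by omega)) hg

theorem Std.mul {f g : OI} (hg : Std g) (hf : Std f) : Std (g * f) := by
  obtain ⟨M, hf⟩ := hf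
  obtain ⟨M', hg⟩ := hg
  exact ⟨_, hf.comp hg⟩

theorem Std.one : Std 1 := ⟨0, fun a => ⟨a, 0, le_rfl, fun y _ _ => by simp⟩⟩

/-- The map collapsing `[i, i+2]` to `[i, i+1]` linearly. -/
noncomputable def mi (i : ℕ) : OI :=
  StrictMono.orderIsoOfRightInverse
    (fun x : ℝ => if x ≤ i then x else if x ≤ i + 2 then (x + i) / 2 else x - 1)
    (by
      intro x y hxy
      dsimp only
      split_ifs <;> linarith)
    (fun x : ℝ => if x ≤ i then x else if x ≤ i + 1 then 2 * x - i else x + 1)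
    (by
      intro x
      dsimp only
      split_ifs <;> linarith)

theorem mi_apply (i : ℕ) (x : ℝ) :
    mi i x = if x ≤ i then x else if x ≤ i + 2 then (x + i) / 2 else x - 1 := rfl

theorem mi_inv_apply (i : ℕ) (x : ℝ) :
    (mi i)⁻¹ x = if x ≤ i then x else if x ≤ i + 1 then 2 * x - i else x + 1 := rfl

theorem mi_le (i : ℕ) {x : ℝ} (h : x ≤ i) : mi i x = x := by
  rw [mi_apply, if_pos h]

theorem mi_ge (i : ℕ) {x : ℝ} (h : (i : ℝ) + 2 ≤ x) : mi i x = x - 1 := by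
  rw [mi_apply]; split_ifs <;> linarith

theorem mi_mid (i : ℕ) : mi i (i + 1) = i + 1 / 2 := by
  rw [mi_apply]; split_ifs <;> linarith

theorem mi_std (i : ℕ) : StdAt 0 (mi i) := by
  intro a
  rcases lt_or_ge a (i : ℤ) with h | h
  · have h' : (a : ℝ) + 1 ≤ i := by exact_mod_cast h
    refine ⟨a, 0, le_rfl, fun y h0 h1 => ?_⟩
    rw [mi_apply]; simp only [pow_zero, div_one]
    rw [if_pos (by linarith)]
  rcases lt_or_ge a (i + 2 : ℤ) with h2 | h2
  · have h' : (i : ℝ) ≤ a := by exact_mod_cast h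
    have h2' : (a : ℝ) + 1 ≤ i + 2 := by exact_mod_cast h2
    refine ⟨a + i, 1, by omega, fun y h0 h1 => ?_⟩
    rw [mi_apply]; simp only [pow_zero, div_one, pow_one]; push_cast
    split_ifs <;> linarith
  · have h' : (i : ℝ) + 2 ≤ a := by exact_mod_cast h2
    refine ⟨a - 1, 0, le_rfl, fun y h0 h1 => ?_⟩
    rw [mi_apply]; simp only [pow_zero, div_one]; push_cast
    split_ifs <;> linarith

theorem mi_inv_std (i : ℕ) : StdAt 1 (mi i)⁻¹ := by
  intro a
  rcases lt_or_ge a (2 * i : ℤ) with h | h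
  · have h' : (a : ℝ) + 1 ≤ 2 * i := by exact_mod_cast h
    refine ⟨a, 1, by omega, fun y h0 h1 => ?_⟩
    rw [mi_inv_apply]; simp only [pow_one]
    rw [if_pos (by linarith)]
  rcases lt_or_ge a (2 * i + 2 : ℤ) with h2 | h2
  · have h' : (2 * i : ℝ) ≤ a := by exact_mod_cast h
    have h2' : (a : ℝ) + 1 ≤ 2 * i + 2 := by exact_mod_cast h2
    refine ⟨a - i, 0, by omega, fun y h0 h1 => ?_⟩
    rw [mi_inv_apply]; simp only [pow_zero, div_one, pow_one]; push_cast
    split_ifs <;> linarith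
  · have h' : (2 * i : ℝ) + 2 ≤ a := by exact_mod_cast h2
    refine ⟨a + 2, 1, by omega, fun y h0 h1 => ?_⟩
    rw [mi_inv_apply]; simp only [pow_one]; push_cast
    split_ifs <;> linarith

theorem mi_rel {i j : ℕ} (h : i < j) : mi i * mi (j + 1) = mi j * mi i := by
  have h' : (i : ℝ) + 1 ≤ j := by exact_mod_cast h
  ext x
  simp only [RelIso.mul_apply, mi_apply]
  push_cast
  split_ifs <;> linarith

/-- Standard maps equal to the identity on the left and to a translation on `[n, ∞)`. -/
structure InV (n : ℕ) (ψ : OI) : Prop where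
  std : Std ψ
  std_inv : Std ψ⁻¹
  left : ∀ x : ℝ, x ≤ 0 → ψ x = x
  right : ∀ x : ℝ, (n : ℝ) ≤ x → ψ x = x - n + 1

theorem InV.mul_mi {n i : ℕ} {ψ : OI} (h : InV (n + 1) ψ) (hi : i ≤ n) :
    InV (n + 2) (ψ * mi i) where
  std := h.std.mul ⟨_, mi_std i⟩
  std_inv := by
    rw [mul_inv_rev]
    exact Std.mul ⟨_, mi_inv_std i⟩ h.std_inv
  left x hx := by
    have : (0 : ℝ) ≤ i := by positivity
    rw [RelIso.mul_apply, mi_le i (by linarith), h.left x hx]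
  right x hx := by
    push_cast at hx
    have : (i : ℝ) ≤ n := by exact_mod_cast hi
    rw [RelIso.mul_apply, mi_ge i (by linarith), h.right _ (by push_cast; linarith)]
    push_cast; ring

theorem InV.of_mul_mi {n i : ℕ} {ψ : OI} (h : InV (n + 2) (ψ * mi i)) (hi : i ≤ n) :
    InV (n + 1) ψ where
  std := by
    have := h.std.mul ⟨_, mi_inv_std i⟩
    rwa [mul_inv_cancel_right] at this
  std_inv := by
    have := h.std_inv
    rw [mul_inv_rev] at this
    have := Std.mul ⟨_, mi_std i⟩ this
    rwa [mul_inv_cancel_left] at this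
  left x hx := by
    have h0 : (0 : ℝ) ≤ i := by positivity
    have := h.left x hx
    rwa [RelIso.mul_apply, mi_le i (by linarith)] at this
  right x hx := by
    push_cast at hx
    have h0 : (i : ℝ) ≤ n := by exact_mod_cast hi
    have := h.right (x + 1) (by push_cast; linarith)
    rw [RelIso.mul_apply, mi_ge i (by linarith)] at this
    push_cast at this
    push_cast
    rw [show x = x + 1 - 1 by ring, this]; ring

theorem InV.left_mul {n : ℕ} {g ψ : OI} (hg : InV 1 g) (h : InV n ψ) : InV n (g * ψ) where
  std := hg.std.mul h.std
  std_inv := by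
    rw [mul_inv_rev]
    exact h.std_inv.mul hg.std_inv
  left x hx := by
    rw [RelIso.mul_apply, h.left x hx, hg.left x hx]
  right x hx := by
    rw [RelIso.mul_apply, h.right x hx, hg.right]
    · push_cast; ring
    · push_cast; linarith

theorem InV.inv_apply {n : ℕ} {ψ : OI} (h : InV n ψ) {x : ℝ} (hx : 1 ≤ x) :
    ψ⁻¹ x = x + n - 1 := by
  have := h.right (x + n - 1) (by linarith)
  have e : x + n - 1 - n + 1 = x := by ring
  rw [e] at this
  conv_lhs => rw [← this]
  rw [RelIso.inv_apply_self]

theorem InV.inv_apply_left {n : ℕ} {ψ : OI} (h : InV n ψ) {x : ℝ} (hx : x ≤ 0) :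
    ψ⁻¹ x = x := by
  conv_lhs => rw [← h.left x hx]
  rw [RelIso.inv_apply_self]

theorem InV.mul_inv {n : ℕ} {ψ ψ' : OI} (h : InV n ψ) (h' : InV n ψ') : InV 1 (ψ' * ψ⁻¹) where
  std := h'.std.mul h.std_inv
  std_inv := by
    rw [mul_inv_rev, inv_inv]
    exact h.std.mul h'.std_inv
  left x hx := by
    rw [RelIso.mul_apply, h.inv_apply_left hx, h'.left x hx]
  right x hx := by
    push_cast at hx
    rw [RelIso.mul_apply, h.inv_apply hx, h'.right _ (by linarith)]
    push_cast; ring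

theorem InV.one : InV 1 1 where
  std := Std.one
  std_inv := by rw [inv_one]; exact Std.one
  left x _ := rfl
  right x _ := by simp

/-- The line version of Thompson's group. -/
def FF : Subgroup OI where
  carrier := {ψ | InV 1 ψ}
  mul_mem' h h' := h.left_mul h'
  one_mem' := InV.one
  inv_mem' h := by simpa using h.mul_inv InV.one

theorem mem_FF {g : OI} : g ∈ FF ↔ InV 1 g := Iff.rfl

end

section

/-- Values of `dup`. -/
theorem dup_apply {n : ℕ} (t : Fin (n + 1) → ℝ) (i : Fin (n + 1)) (l : Fin (n + 2)) :
    dup t i l = t (i.predAbove l) := by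
  unfold dup
  rcases eq_or_ne l i.castSucc with rfl | h
  · simp
  · obtain ⟨k, rfl⟩ := Fin.exists_succAbove_eq h
    rw [Fin.insertNth_apply_succAbove]
    simp

theorem dup_comp {n m : ℕ} (s : Fin m → ℝ) (κ : Fin (n + 1) → Fin m) (i : Fin (n + 1)) :
    dup (s ∘ κ) i = s ∘ (κ ∘ i.predAbove) := by
  ext l; rw [dup_apply]; rfl

theorem predAbove_val {n : ℕ} (i : Fin (n + 1)) (l : Fin (n + 2)) :
    (i.predAbove l : ℕ) = if (i : ℕ) < l then (l : ℕ) - 1 else l := by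
  unfold Fin.predAbove
  by_cases h : (i : ℕ) < l
  · rw [dif_pos (by rw [Fin.lt_def]; exact h), if_pos h]; rfl
  · rw [dif_neg (by rw [Fin.lt_def]; exact h), if_neg h]; rfl

/-- The index shift caused by duplicating the entry `i`. -/
abbrev iot {n : ℕ} (i j : Fin (n + 1)) : Fin (n + 2) := i.castSucc.succAbove j

theorem iot_val {n : ℕ} (i j : Fin (n + 1)) :
    (iot i j : ℕ) = if (j : ℕ) < i then (j : ℕ) else j + 1 := by
  unfold iot Fin.succAbove
  by_cases h : (j : ℕ) < i
  · rw [if_pos (by rw [Fin.lt_def]; exact h), if_pos h]; rfl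
  · rw [if_neg (by rw [Fin.lt_def]; exact h), if_neg h]; rfl

theorem dup_iot {n : ℕ} (t : Fin (n + 1) → ℝ) (i l : Fin (n + 1)) :
    dup t i (iot i l) = t l := by
  unfold dup
  rw [Fin.insertNth_apply_succAbove]

theorem dup_self {n : ℕ} (t : Fin (n + 1) → ℝ) (i : Fin (n + 1)) :
    dup t i i.castSucc = t i := by
  unfold dup
  rw [Fin.insertNth_apply_same]

theorem dup_succ {n : ℕ} (t : Fin (n + 1) → ℝ) (i : Fin (n + 1)) :
    dup t i i.succ = t i := by
  rw [dup_apply]; simp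

theorem dup_inj {n : ℕ} {t t' : Fin (n + 1) → ℝ} {i : Fin (n + 1)} (h : dup t i = dup t' i) :
    t = t' := by
  ext l
  rw [← dup_iot t i l, h, dup_iot]

theorem dup_dup {n : ℕ} (t : Fin (n + 1) → ℝ) {i j : Fin (n + 1)} (h : i ≠ j) :
    dup (dup t i) (iot i j) = dup (dup t j) (iot j i) := by
  ext l
  simp only [dup_apply]
  congr 1
  ext
  have h' : (i : ℕ) ≠ j := fun e => h (Fin.ext e)
  simp only [predAbove_val, iot_val]
  split_ifs <;> omega

theorem mi_iot {n : ℕ} {i j : Fin (n + 1)} (h : i ≠ j) :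
    mi i * mi (iot i j : Fin (n + 2)) = mi j * mi (iot j i : Fin (n + 2)) := by
  have h' : (i : ℕ) ≠ j := fun e => h (Fin.ext e)
  rcases lt_or_gt_of_ne h' with h1 | h1
  · rw [iot_val, iot_val, if_neg (by omega), if_pos h1, mi_rel h1]
  · rw [iot_val, iot_val, if_pos h1, if_neg (by omega), mi_rel h1]

theorem CFset.span {n : ℕ} {t : Fin n → ℝ} (h : t ∈ CFset n) {a b : Fin n}
    (hab : (a : ℕ) + 2 ≤ b) : 1 ≤ t b - t a := by
  have h1 := h.2 a (by omega)
  have h2 : t ⟨a + 2, by omega⟩ ≤ t b := h.1 (by rw [Fin.le_def]; exact hab)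
  have h3 : t ⟨a, by omega⟩ = t a := rfl
  linarith

theorem CFset.mk {n : ℕ} {t : Fin n → ℝ} (h1 : ∀ a b, a < b → t a ≤ t b)
    (h2 : ∀ a b : Fin n, (a : ℕ) + 2 ≤ b → 1 ≤ t b - t a) : t ∈ CFset n := by
  refine ⟨fun a b hab => ?_, fun i h => h2 _ _ (by simp)⟩
  rcases hab.eq_or_lt with rfl | h
  · exact le_rfl
  · exact h1 _ _ h

theorem CFset.of_dup {n : ℕ} {t : Fin (n + 1) → ℝ} {i : Fin (n + 1)}
    (h : dup t i ∈ CFset (n + 2)) : t ∈ CFset (n + 1) := by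
  refine CFset.mk (fun a b hab => ?_) (fun a b hab => ?_)
  · rw [← dup_iot t i a, ← dup_iot t i b]
    apply h.1
    rw [Fin.le_def, iot_val, iot_val]
    rw [Fin.lt_def] at hab
    split_ifs <;> omega
  · rw [← dup_iot t i a, ← dup_iot t i b]
    apply CFset.span h
    rw [iot_val, iot_val]
    split_ifs <;> omega

theorem CFset.isolated {n : ℕ} {t : Fin (n + 1) → ℝ} {i : Fin (n + 1)}
    (h : dup t i ∈ CFset (n + 2)) (l : Fin (n + 1)) (hl : l ≠ i) : 1 ≤ |t l - t i| := by
  have hl' : (l : ℕ) ≠ i := fun e => hl (Fin.ext e)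
  rcases lt_or_gt_of_ne hl' with h1 | h1
  · have := CFset.span h (a := iot i l) (b := i.succ) (by
      rw [iot_val, if_pos h1, Fin.val_succ]; omega)
    rw [dup_iot, dup_succ] at this
    rw [abs_sub_comm]
    exact this.trans (le_abs_self _)
  · have := CFset.span h (a := i.castSucc) (b := iot i l) (by
      rw [iot_val, if_neg (by omega), Fin.val_castSucc]; omega)
    rw [dup_iot, dup_self] at this
    exact this.trans (le_abs_self _)

theorem CFset.dup_mem {n : ℕ} {t : Fin (n + 1) → ℝ} {i : Fin (n + 1)}
    (ht : t ∈ CFset (n + 1)) (h : ∀ l, l ≠ i → 1 ≤ |t l - t i|) : dup t i ∈ CFset (n + 2) := by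
  have key : ∀ a b : Fin (n + 1), a < b → (a = i ∨ b = i) → 1 ≤ t b - t a := by
    rintro a b hab (rfl | rfl)
    · have := h b hab.ne'
      rwa [abs_of_nonneg (sub_nonneg.2 (ht.1 hab.le))] at this
    · have := h a hab.ne
      rwa [abs_sub_comm, abs_of_nonneg (sub_nonneg.2 (ht.1 hab.le))] at this
  refine CFset.mk (fun a b hab => ?_) (fun a b hab => ?_)
  · rw [dup_apply, dup_apply]
    apply ht.1
    rw [Fin.le_def, predAbove_val, predAbove_val]
    rw [Fin.lt_def] at hab
    split_ifs <;> omega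
  · rw [dup_apply, dup_apply]
    by_cases h2 : ((i.predAbove a : Fin (n + 1)) : ℕ) + 2 ≤ (i.predAbove b : Fin (n + 1))
    · exact CFset.span ht h2
    · have ha := predAbove_val i a
      have hb := predAbove_val i b
      apply key
      · rw [Fin.lt_def, ha, hb]; split_ifs <;> omega
      · rw [ha, hb] at h2
        rw [Fin.ext_iff, Fin.ext_iff, ha, hb]
        split_ifs at * <;> omega

/-- A tuple with two equal consecutive entries is a duplicate. -/
theorem exists_dup {n : ℕ} {t : Fin (n + 2) → ℝ} {i : Fin (n + 1)}
    (h : t i.castSucc = t i.succ) : t = dup (fun l => t (iot i l)) i := by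
  ext l
  rw [dup_apply]
  have hv : ((iot i (i.predAbove l) : Fin (n + 2)) : ℕ) = if (l : ℕ) = i then (i : ℕ) + 1 else l := by
    rw [iot_val, predAbove_val]; split_ifs <;> omega
  by_cases hl : (l : ℕ) = i
  · have e1 : l = i.castSucc := Fin.ext hl
    have e2 : iot i (i.predAbove l) = i.succ := by
      ext; rw [hv, if_pos hl]; rfl
    show t l = t (iot i (i.predAbove l))
    rw [e2, e1, h]
  · have e2 : iot i (i.predAbove l) = l := by
      ext; rw [hv, if_neg hl]
    show t l = t (iot i (i.predAbove l))
    rw [e2]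

theorem CFset.not_strict {n : ℕ} {t : Fin (n + 1) → ℝ} (ht : t ∈ CFset (n + 1))
    (h : ¬ StrictMono t) : ∃ m, ∃ (e : n = m + 1), ∃ i : Fin (m + 1),
      t ⟨i, by omega⟩ = t ⟨i + 1, by omega⟩ := by
  cases n with
  | zero =>
    exfalso; apply h
    intro a b hab
    rw [Fin.lt_def] at hab
    omega
  | succ m =>
    refine ⟨m, rfl, ?_⟩
    by_contra hc
    push Not at hc
    apply h
    rw [Fin.strictMono_iff_lt_succ]
    intro i
    exact lt_of_le_of_ne (ht.1 (Fin.castSucc_lt_succ).le) (hc i)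

/-- The diamond configuration: two different merges. -/
theorem CFset.diamond {n : ℕ} {t t' : Fin (n + 1) → ℝ} {i j : Fin (n + 1)}
    (h : dup t i ∈ CFset (n + 2)) (e : dup t i = dup t' j) (hij : (i : ℕ) < j) :
    ∃ (m : ℕ) (_ : n = m + 1) (i' j' : Fin (m + 1)) (u : Fin (m + 1) → ℝ), i' ≠ j' ∧
      (i : ℕ) = (iot j' i' : Fin (m + 2)) ∧ (j : ℕ) = (iot i' j' : Fin (m + 2)) ∧
      (∀ l : Fin (n + 1), t l = dup u j' ⟨l, by omega⟩) ∧
      (∀ l : Fin (n + 1), t' l = dup u i' ⟨l, by omega⟩) := by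
  have hij2 : (i : ℕ) + 2 ≤ j := by
    by_contra hc
    have hj : (j : ℕ) = i + 1 := by omega
    have h1 := CFset.span h (a := i.castSucc) (b := j.succ) (by simp; omega)
    have e1 : dup t i j.castSucc = dup t i i.succ := by congr 1; ext; simp [hj]
    have e2 : dup t i j.succ = dup t i j.castSucc := by rw [e, dup_self, dup_succ]
    rw [e2, e1, dup_succ, dup_self] at h1
    linarith
  obtain ⟨m, rfl⟩ : ∃ m, n = m + 1 := ⟨n - 1, by omega⟩
  have ht : ∀ l, t l = dup t' j (iot i l) := fun l => by rw [← e, dup_iot]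
  have ht' : ∀ l, t' l = dup t i (iot j l) := fun l => by rw [e, dup_iot]
  let i' : Fin (m + 1) := ⟨i, by omega⟩
  let j' : Fin (m + 1) := ⟨j - 1, by omega⟩
  refine ⟨m, rfl, i', j', fun l => t (iot j' l), ?_, ?_, ?_, ?_, ?_⟩
  · intro h; have := congrArg Fin.val h; simp [i', j'] at this; omega
  · rw [iot_val]; simp only [i', j']; split_ifs <;> omega
  · rw [iot_val]; simp only [i', j']; split_ifs <;> omega
  · have e3 : t j'.castSucc = t j'.succ := by
      rw [ht, ht, dup_apply, dup_apply]
      congr 1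
      ext
      simp only [predAbove_val, iot_val, j', Fin.val_castSucc, Fin.val_succ]
      split_ifs <;> omega
    intro l
    exact congrFun (exists_dup e3) l
  · intro l
    rw [ht', dup_apply, dup_apply]
    congr 1
    ext
    simp only [predAbove_val, iot_val, i', j']
    split_ifs <;> omega

end

section

/-- All labelled cells. -/
def Call : Set (ℕ × OI) := {c | InV (c.1 + 1) c.2}

/-- The disjoint union of the cells in `C`. -/
abbrev PreE (C : Set (ℕ × OI)) := (c : C) × CFn (c.1.1 + 1)

/-- The gluing relation on cells. -/
def ERel (C : Set (ℕ × OI)) : PreE C → PreE C → Prop := fun x y =>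
  ∃ (i : Fin (x.1.1.1 + 1)) (hc : (x.1.1.1 + 1, x.1.1.2 * mi i) ∈ C)
    (h : dup (x.2 : Fin (x.1.1.1 + 1) → ℝ) i ∈ CFset (x.1.1.1 + 2)),
    y = ⟨⟨(x.1.1.1 + 1, x.1.1.2 * mi i), hc⟩, ⟨dup (x.2 : Fin (x.1.1.1 + 1) → ℝ) i, h⟩⟩

/-- The complex glued from cells in `C`. -/
abbrev EE (C : Set (ℕ × OI)) := Quot (ERel C)

/-- Points of the disjoint union. -/
abbrev pt {C : Set (ℕ × OI)} {n : ℕ} {ψ : OI} (hc : (n, ψ) ∈ C) {t : Fin (n + 1) → ℝ}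
    (ht : t ∈ CFset (n + 1)) : PreE C := ⟨⟨(n, ψ), hc⟩, ⟨t, ht⟩⟩

/-- Points of the complex. -/
abbrev qt {C : Set (ℕ × OI)} {n : ℕ} {ψ : OI} (hc : (n, ψ) ∈ C) {t : Fin (n + 1) → ℝ}
    (ht : t ∈ CFset (n + 1)) : EE C := Quot.mk _ (pt hc ht)

theorem ERel.step {C : Set (ℕ × OI)} {n : ℕ} {ψ ψ' : OI} (hc : (n, ψ) ∈ C)
    {t : Fin (n + 1) → ℝ} (ht : t ∈ CFset (n + 1)) (i : Fin (n + 1))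
    (hc' : (n + 1, ψ') ∈ C) {t' : Fin (n + 2) → ℝ} (ht' : t' ∈ CFset (n + 2))
    (e1 : ψ' = ψ * mi i) (e2 : t' = dup t i) : ERel C (pt hc ht) (pt hc' ht') := by
  subst e1; subst e2
  exact ⟨i, hc', ht', rfl⟩

theorem qt_step {C : Set (ℕ × OI)} {n : ℕ} {ψ ψ' : OI} (hc : (n, ψ) ∈ C)
    {t : Fin (n + 1) → ℝ} (ht : t ∈ CFset (n + 1)) (i : Fin (n + 1))
    (hc' : (n + 1, ψ') ∈ C) {t' : Fin (n + 2) → ℝ} (ht' : t' ∈ CFset (n + 2))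
    (e1 : ψ' = ψ * mi i) (e2 : t' = dup t i) : qt hc ht = qt hc' ht' :=
  Quot.sound (ERel.step hc ht i hc' ht' e1 e2)

theorem pt_inj {C : Set (ℕ × OI)} {n n' : ℕ} {ψ ψ' : OI} {hc : (n, ψ) ∈ C} {hc' : (n', ψ') ∈ C}
    {t : Fin (n + 1) → ℝ} {ht : t ∈ CFset (n + 1)} {t' : Fin (n' + 1) → ℝ}
    {ht' : t' ∈ CFset (n' + 1)} (h : pt hc ht = pt hc' ht') :
    ∃ e : n = n', ψ = ψ' ∧ t = fun l : Fin (n + 1) => t' ⟨l, by omega⟩ := by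
  have h1 : (n, ψ) = (n', ψ') := congrArg (fun x : PreE C => x.1.1) h
  obtain ⟨e, e'⟩ := Prod.mk.inj h1
  subst e; subst e'
  refine ⟨rfl, rfl, ?_⟩
  have h2 := eq_of_heq (Sigma.mk.inj h).2
  exact congrArg Subtype.val h2

theorem diamond_lt {n : ℕ} {ψ ψ' : OI} {t t' : Fin (n + 1) → ℝ} {i j : Fin (n + 1)}
    (hψ : (n, ψ) ∈ Call) (hψ' : (n, ψ') ∈ Call) (ht : t ∈ CFset (n + 1)) (ht' : t' ∈ CFset (n + 1))
    (h : dup t i ∈ CFset (n + 2)) (e : dup t i = dup t' j) (eψ : ψ * mi i = ψ' * mi j)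
    (hij : (i : ℕ) < j) :
    ∃ d : PreE Call, ERel Call d (pt hψ ht) ∧ ERel Call d (pt hψ' ht') := by
  obtain ⟨m, rfl, i', j', u, hne, hi, hj, htu, htu'⟩ := CFset.diamond h e hij
  have htu : t = dup u j' := funext htu
  have htu' : t' = dup u i' := funext htu'
  have e1 : ψ = (ψ * (mi j')⁻¹) * mi j' := by simp
  have e2 : ψ' = (ψ * (mi j')⁻¹) * mi i' := by
    rw [hi, hj] at eψ
    rw [eq_comm, ← mul_left_inj (mi (iot i' j' : Fin (m + 2)))]
    rw [mul_assoc, mi_iot hne, ← eψ]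
    simp [mul_assoc]
  have hχ : InV (m + 1) (ψ * (mi j')⁻¹) :=
    InV.of_mul_mi (i := j') (by rw [← e1]; exact hψ) (by omega)
  have hu : u ∈ CFset (m + 1) := CFset.of_dup (by rw [← htu]; exact ht)
  exact ⟨pt (C := Call) (n := m) hχ hu, ERel.step _ _ j' _ _ e1 htu, ERel.step _ _ i' _ _ e2 htu'⟩

theorem ERel.diamond {a b c : PreE Call} (hb : ERel Call b a) (hc : ERel Call c a) :
    b = c ∨ ∃ d, ERel Call d b ∧ ERel Call d c := by
  obtain ⟨⟨⟨n, ψ⟩, hψ⟩, ⟨t, ht⟩⟩ := b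
  obtain ⟨⟨⟨n', ψ'⟩, hψ'⟩, ⟨t', ht'⟩⟩ := c
  obtain ⟨i, hi, hit, rfl⟩ := hb
  obtain ⟨j, hj, hjt, e⟩ := hc
  obtain ⟨e0, e1, e2⟩ := pt_inj e
  simp only at e0 e1 e2 hi hit hj hjt i j
  obtain rfl : n = n' := by omega
  have e2 : dup t i = dup t' j := e2
  rcases lt_trichotomy (i : ℕ) j with h | h | h
  · exact Or.inr (diamond_lt hψ hψ' ht ht' hit e2 e1 h)
  · left
    obtain rfl : i = j := Fin.ext h
    obtain rfl := dup_inj e2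
    have := mul_right_cancel e1
    subst this
    rfl
  · obtain ⟨d, h1, h2⟩ := diamond_lt hψ' hψ ht' ht hjt e2.symm e1.symm h
    exact Or.inr ⟨d, h2, h1⟩

/-- The merging relation. -/
def Mrg : PreE Call → PreE Call → Prop := fun a b => ERel Call b a

theorem join_of_eq {x y : PreE Call} (h : (Quot.mk _ x : EE Call) = Quot.mk _ y) :
    Relation.Join (Relation.ReflTransGen Mrg) x y := by
  have cr : ∀ a b c, Mrg a b → Mrg a c →
      ∃ d, Relation.ReflGen Mrg b d ∧ Relation.ReflTransGen Mrg c d := by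
    intro a b c hb hc
    rcases ERel.diamond hb hc with rfl | ⟨d, h1, h2⟩
    · exact ⟨b, Relation.ReflGen.refl, Relation.ReflTransGen.refl⟩
    · exact ⟨d, Relation.ReflGen.single h1, Relation.ReflTransGen.single h2⟩
  have eq := Relation.equivalence_join_reflTransGen cr
  replace h := Quot.eqvGen_exact h
  induction h with
  | rel a b hab => exact ⟨a, Relation.ReflTransGen.refl, Relation.ReflTransGen.single hab⟩
  | refl a => exact eq.refl a
  | symm a b _ ih => exact eq.symm ih
  | trans a b c _ _ ih1 ih2 => exact eq.trans ih1 ih2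

theorem not_mrg_of_strict {x y : PreE Call} (hx : StrictMono x.2.1) : ¬ Mrg x y := by
  rintro ⟨i, hc, h, rfl⟩
  have : dup y.2.1 i i.castSucc < dup y.2.1 i i.succ := hx (Fin.castSucc_lt_succ)
  rw [dup_self, dup_succ] at this
  exact lt_irrefl _ this

theorem mrg_of_eq_strict {x y : PreE Call} (hx : StrictMono x.2.1)
    (h : (Quot.mk _ y : EE Call) = Quot.mk _ x) : Relation.ReflTransGen Mrg y x := by
  obtain ⟨z, h1, h2⟩ := join_of_eq h
  rcases Relation.ReflTransGen.cases_head h2 with rfl | ⟨w, hw, -⟩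
  · exact h1
  · exact absurd hw (not_mrg_of_strict hx)

theorem eq_of_strict {x y : PreE Call} (hx : StrictMono x.2.1) (hy : StrictMono y.2.1)
    (h : (Quot.mk _ y : EE Call) = Quot.mk _ x) : y = x := by
  rcases Relation.ReflTransGen.cases_head (mrg_of_eq_strict hx h) with rfl | ⟨w, hw, -⟩
  · rfl
  · exact absurd hw (not_mrg_of_strict hy)

theorem exists_strict_aux (N : ℕ) : ∀ x : PreE Call, x.1.1.1 = N →
    ∃ y : PreE Call, StrictMono y.2.1 ∧ (Quot.mk _ x : EE Call) = Quot.mk _ y := by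
  induction N with
  | zero =>
    intro x hx
    refine ⟨x, ?_, rfl⟩
    intro a b hab
    rw [Fin.lt_def] at hab
    omega
  | succ m ih =>
    intro x hx
    by_cases hs : StrictMono x.2.1
    · exact ⟨x, hs, rfl⟩
    obtain ⟨⟨⟨n, ψ⟩, hψ⟩, ⟨t, ht⟩⟩ := x
    obtain ⟨m', e, i, hi⟩ := CFset.not_strict ht hs
    simp only at hx e
    obtain rfl : m' = m := by omega
    subst e
    have hd := exists_dup (t := t) (i := i) hi
    have hχ : InV (m' + 1) (ψ * (mi i)⁻¹) :=
      InV.of_mul_mi (i := i) (by rw [inv_mul_cancel_right]; exact hψ) (by omega)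
    have hu : (fun l => t (iot i l)) ∈ CFset (m' + 1) := CFset.of_dup (by rw [← hd]; exact ht)
    obtain ⟨y, hy, hy'⟩ := ih (pt (C := Call) (n := m') hχ hu) rfl
    refine ⟨y, hy, ?_⟩
    rw [← hy']
    exact (qt_step _ _ i _ _ (by simp) hd).symm

theorem exists_strict (e : EE Call) : ∃ (n : ℕ) (ψ : OI) (hc : (n, ψ) ∈ Call)
    (s : Fin (n + 1) → ℝ) (hs : s ∈ CFset (n + 1)), StrictMono s ∧ e = qt hc hs := by
  induction e using Quot.ind with
  | mk x =>
    obtain ⟨⟨⟨⟨n, ψ⟩, hc⟩, ⟨s, hs⟩⟩, h1, h2⟩ := exists_strict_aux _ x rfl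
    exact ⟨n, ψ, hc, s, hs, h1, h2⟩

/-! ### The action -/

/-- The action on points. -/
def preAct (g : FF) (x : PreE Call) : PreE Call :=
  ⟨⟨(x.1.1.1, g * x.1.1.2), InV.left_mul g.2 x.1.2⟩, x.2⟩

theorem preAct_rel (g : FF) {x y : PreE Call} (h : ERel Call x y) :
    ERel Call (preAct g x) (preAct g y) := by
  obtain ⟨⟨⟨n, ψ⟩, hψ⟩, ⟨t, ht⟩⟩ := x
  obtain ⟨i, hc, h, rfl⟩ := h
  exact ERel.step _ _ i _ _ (mul_assoc _ _ _).symm rfl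

instance actE : MulAction FF (EE Call) where
  smul g := Quot.map (preAct g) (fun _ _ h => preAct_rel g h)
  one_smul e := by
    induction e using Quot.ind with
    | mk x => rfl
  mul_smul g h e := by
    induction e using Quot.ind with
    | mk x => rfl

theorem smul_qt (g : FF) {n : ℕ} {ψ : OI} (hc : (n, ψ) ∈ Call) {t : Fin (n + 1) → ℝ}
    (ht : t ∈ CFset (n + 1)) :
    g • (qt hc ht : EE Call) = qt (C := Call) (n := n) (ψ := g * ψ) (InV.left_mul g.2 hc) ht := rfl

instance : ContinuousConstSMul FF (EE Call) where
  continuous_const_smul g := by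
    refine continuous_quot_lift _ ?_
    refine continuous_quot_mk.comp ?_
    refine continuous_sigma fun c => ?_
    exact continuous_sigmaMk (σ := fun c : Call => CFn (c.1.1 + 1))
      (i := ⟨(c.1.1, g * c.1.2), InV.left_mul g.2 c.2⟩)

theorem smulE_eq_self {g : FF} {e : EE Call} (h : g • e = e) : g = 1 := by
  obtain ⟨n, ψ, hc, s, hs, hst, rfl⟩ := exists_strict e
  rw [smul_qt] at h
  have := eq_of_strict (x := pt hc hs) (y := pt _ hs) hst hst h
  obtain ⟨_, h2, _⟩ := pt_inj this
  ext1
  simpa using h2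

/-! ### The projection -/

/-- Forgetting the label. -/
def preP (x : PreE Call) : PreCF := ⟨x.1.1.1, x.2⟩

/-- The projection to `CF`. -/
def pE : EE Call → CF := Quot.map preP (by
  rintro x y ⟨i, hc, h, rfl⟩
  exact ⟨i, h, rfl⟩)

theorem continuous_preP : Continuous preP :=
  continuous_sigma fun c =>
    continuous_sigmaMk (σ := fun n : ℕ => CFn (n + 1)) (i := c.1.1)

theorem exists_InV (n : ℕ) : ∃ ψ, InV (n + 1) ψ := by
  induction n with
  | zero => exact ⟨1, InV.one⟩
  | succ n ih =>
    obtain ⟨ψ, h⟩ := ih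
    exact ⟨_, h.mul_mi (Nat.zero_le _)⟩

theorem preP_surj : Function.Surjective preP := by
  rintro ⟨n, t⟩
  obtain ⟨ψ, h⟩ := exists_InV n
  exact ⟨⟨⟨(n, ψ), h⟩, t⟩, rfl⟩

theorem preP_open : IsOpenMap preP := by
  rw [isOpenMap_sigma]
  intro c
  exact isOpenMap_sigmaMk (σ := fun n : ℕ => CFn (n + 1)) (i := c.1.1)

theorem continuous_pE : Continuous pE :=
  continuous_quot_lift _ (continuous_quot_mk.comp continuous_preP)

theorem isQuotientMap_pE : Topology.IsQuotientMap pE := by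
  have h1 : Topology.IsQuotientMap (Quot.mk CFrel ∘ preP) :=
    isQuotientMap_quot_mk.comp (preP_open.isQuotientMap continuous_preP preP_surj)
  exact Topology.IsQuotientMap.of_comp (f := Quot.mk (ERel Call)) (g := pE)
    continuous_quot_mk continuous_pE h1

theorem pE_smul (g : FF) (e : EE Call) : pE (g • e) = pE e := by
  induction e using Quot.ind with
  | mk x => rfl

theorem lift_eqvGen {u v : PreCF} (h : Relation.EqvGen CFrel u v) :
    (∀ ψ (hψ : (u.1, ψ) ∈ Call), ∃ ψ', ∃ hψ' : (v.1, ψ') ∈ Call,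
      (qt hψ u.2.2 : EE Call) = qt hψ' v.2.2) ∧
    (∀ ψ (hψ : (v.1, ψ) ∈ Call), ∃ ψ', ∃ hψ' : (u.1, ψ') ∈ Call,
      (qt hψ v.2.2 : EE Call) = qt hψ' u.2.2) := by
  induction h with
  | rel a b hab =>
    obtain ⟨n, t, ht⟩ := a
    obtain ⟨i, hi, rfl⟩ := hab
    constructor
    · intro ψ hψ
      exact ⟨ψ * mi i, InV.mul_mi hψ (Nat.lt_succ_iff.1 i.2),
        qt_step _ _ i _ _ rfl rfl⟩
    · intro ψ hψ
      refine ⟨ψ * (mi i)⁻¹, ?_, ?_⟩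
      · exact InV.of_mul_mi (i := i) (by rw [inv_mul_cancel_right]; exact hψ)
          (Nat.lt_succ_iff.1 i.2)
      · exact (qt_step _ _ i _ _ (by simp) rfl).symm
  | refl a => exact ⟨fun ψ h => ⟨ψ, h, rfl⟩, fun ψ h => ⟨ψ, h, rfl⟩⟩
  | symm a b _ ih => exact ⟨ih.2, ih.1⟩
  | trans a b c _ _ ih1 ih2 =>
    constructor
    · intro ψ h
      obtain ⟨ψ1, h1, e1⟩ := ih1.1 ψ h
      obtain ⟨ψ2, h2, e2⟩ := ih2.1 ψ1 h1
      exact ⟨ψ2, h2, e1.trans e2⟩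
    · intro ψ h
      obtain ⟨ψ1, h1, e1⟩ := ih2.2 ψ h
      obtain ⟨ψ2, h2, e2⟩ := ih1.2 ψ1 h1
      exact ⟨ψ2, h2, e1.trans e2⟩

theorem pE_eq_iff {e₁ e₂ : EE Call} : pE e₁ = pE e₂ ↔ e₁ ∈ MulAction.orbit FF e₂ := by
  constructor
  · intro h
    induction e₁ using Quot.ind with
    | mk x =>
    induction e₂ using Quot.ind with
    | mk y =>
    obtain ⟨ψ', h', e⟩ := (lift_eqvGen (Quot.eqvGen_exact h)).1 x.1.1.2 x.1.2
    refine ⟨⟨ψ' * y.1.1.2⁻¹, InV.mul_inv y.1.2 h'⟩, ?_⟩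
    refine Eq.trans ?_ e.symm
    have hy : ψ' * y.1.1.2⁻¹ * y.1.1.2 = ψ' := by simp
    show (Quot.mk _ (preAct _ y) : EE Call) = _
    congr 1
    unfold preAct
    congr 1
    ext1
    exact Prod.ext rfl hy
  · rintro ⟨g, rfl⟩
    exact pE_smul g e₂

end

section

open Filter Topology

/-- The scale `ε` separates the configuration `s`. -/
def Good {m : ℕ} (s : Fin m → ℝ) (ε : ℝ) : Prop :=
  0 < ε ∧ ∀ a b, (s a < s b → 2 * ε < s b - s a) ∧ (s b - s a < 1 → s b - s a < 1 - 2 * ε)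

theorem exists_good {m : ℕ} (s : Fin m → ℝ) : ∃ ε, Good s ε := by
  have key : ∀ c : ℝ, 0 < c → ∀ᶠ ε in 𝓝[>] (0 : ℝ), 2 * ε < c := by
    intro c hc
    filter_upwards [Ioo_mem_nhdsGT (show (0 : ℝ) < c / 2 by linarith)] with ε hε
    have := hε.2
    linarith
  have : ∀ᶠ ε in 𝓝[>] (0 : ℝ), Good s ε := by
    refine Filter.Eventually.and self_mem_nhdsWithin ?_
    rw [Filter.eventually_all]; intro a
    rw [Filter.eventually_all]; intro b
    refine Filter.Eventually.and ?_ ?_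
    · by_cases h : s a < s b
      · filter_upwards [key _ (sub_pos.2 h)] with ε hε _ using hε
      · exact Eventually.of_forall fun ε h' => absurd h' h
    · by_cases h : s b - s a < 1
      · filter_upwards [key _ (sub_pos.2 h)] with ε hε _
        linarith
      · exact Eventually.of_forall fun ε h' => absurd h' h
  exact this.exists

theorem Good.eq {m : ℕ} {s : Fin m → ℝ} {ε : ℝ} (h : Good s ε) (hs : StrictMono s) {a b : Fin m}
    {x : ℝ} (ha : |x - s a| < ε) (hb : |x - s b| < ε) : a = b := by
  rw [abs_lt] at ha hb
  by_contra hne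
  rcases lt_or_gt_of_ne (fun e => hne (hs.injective e)) with h1 | h1
  · have := (h.2 _ _).1 h1
    linarith
  · have := (h.2 _ _).1 h1
    linarith

theorem Good.mem {m n : ℕ} {s : Fin m → ℝ} {ε : ℝ} (h : Good s ε) {t : Fin n → ℝ}
    (ht : t ∈ CFset n) {κ : Fin n → Fin m} (hκ : ∀ i, |t i - s (κ i)| < ε) :
    s ∘ κ ∈ CFset n := by
  refine CFset.mk (fun a b hab => ?_) (fun a b hab => ?_)
  · by_contra hc
    push Not at hc
    have h1 := (h.2 _ _).1 hc
    have h2 := ht.1 hab.le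
    have ha := abs_lt.1 (hκ a)
    have hb := abs_lt.1 (hκ b)
    linarith
  · by_contra hc
    push Not at hc
    have h1 := (h.2 _ _).2 hc
    have h2 := CFset.span ht hab
    have ha := abs_lt.1 (hκ a)
    have hb := abs_lt.1 (hκ b)
    linarith

/-- The preimage of the basic neighbourhood of `e` at scale `ε`. -/
def nbhd {m : ℕ} (s : Fin m → ℝ) (ε : ℝ) (e : EE Call) : Set (PreE Call) :=
  {y | ∃ (κ : Fin (y.1.1.1 + 1) → Fin m) (h : s ∘ κ ∈ CFset (y.1.1.1 + 1)),
    (∀ i, |y.2.1 i - s (κ i)| < ε) ∧ (Quot.mk _ ⟨y.1, ⟨s ∘ κ, h⟩⟩ : EE Call) = e}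

theorem nbhd_sat {m : ℕ} {s : Fin m → ℝ} {ε : ℝ} (h : Good s ε) (hs : StrictMono s) (e : EE Call)
    {x y : PreE Call} (hxy : ERel Call x y) : x ∈ nbhd s ε e ↔ y ∈ nbhd s ε e := by
  obtain ⟨⟨⟨n, ψ⟩, hψ⟩, ⟨t, ht⟩⟩ := x
  obtain ⟨i, hi, hit, rfl⟩ := hxy
  simp only at i hi hit
  constructor
  · rintro ⟨κ, h1, h2, h3⟩
    simp only at κ h1 h2 h3
    have hκ : ∀ l, |dup t i l - s ((κ ∘ i.predAbove) l)| < ε := fun l => by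
      rw [dup_apply]; exact h2 _
    refine ⟨κ ∘ i.predAbove, h.mem hit hκ, hκ, ?_⟩
    rw [← h3]
    exact (qt_step _ _ i _ _ rfl (dup_comp s κ i).symm).symm
  · rintro ⟨κ, h1, h2, h3⟩
    simp only at κ h1 h2 h3
    have e1 : κ i.castSucc = κ i.succ := by
      refine h.eq hs (h2 _) ?_
      have := h2 i.succ
      rw [dup_succ] at this
      rwa [dup_self]
    have e2 : s ∘ κ = dup (s ∘ fun l => κ (iot i l)) i :=
      exists_dup (t := s ∘ κ) (congrArg s e1)
    refine ⟨fun l => κ (iot i l), CFset.of_dup (i := i) (by rw [← e2]; exact h1), fun l => ?_, ?_⟩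
    · have := h2 (iot i l)
      rwa [dup_iot] at this
    · rw [← h3]
      exact qt_step _ _ i _ _ rfl e2

theorem nbhd_open {m : ℕ} {s : Fin m → ℝ} {ε : ℝ} (h : Good s ε) (e : EE Call) :
    IsOpen (nbhd s ε e) := by
  rw [isOpen_sigma_iff]
  intro c
  have : ((fun t : CFn (c.1.1 + 1) => (⟨c, t⟩ : PreE Call)) ⁻¹' nbhd s ε e) =
      ⋃ (κ : Fin (c.1.1 + 1) → Fin m), ⋃ (_ : ∃ h : s ∘ κ ∈ CFset (c.1.1 + 1),
        (Quot.mk _ ⟨c, ⟨s ∘ κ, h⟩⟩ : EE Call) = e), {t | ∀ i, |t.1 i - s (κ i)| < ε} := by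
    ext t
    simp only [Set.mem_preimage, nbhd, Set.mem_ofPred_eq, Set.mem_iUnion]
    constructor
    · rintro ⟨κ, h1, h2, h3⟩
      exact ⟨κ, ⟨h1, h3⟩, h2⟩
    · rintro ⟨κ, ⟨h1, h3⟩, h2⟩
      exact ⟨κ, h1, h2, h3⟩
  change IsOpen ((fun t : CFn (c.1.1 + 1) => (⟨c, t⟩ : PreE Call)) ⁻¹' nbhd s ε e)
  rw [this]
  refine isOpen_iUnion fun κ => isOpen_iUnion fun _ => ?_
  simp only [Set.ofPred_forall]
  refine isOpen_iInter_of_finite fun i => ?_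
  exact isOpen_lt
    ((((continuous_apply i).comp continuous_subtype_val).sub continuous_const).abs) continuous_const

/-- The basic neighbourhood of `e` at scale `ε`. -/
def nbhdE {m : ℕ} {s : Fin m → ℝ} {ε : ℝ} (h : Good s ε) (hs : StrictMono s) (e : EE Call) :
    Set (EE Call) :=
  {x | Quot.lift (fun y => y ∈ nbhd s ε e) (fun _ _ h' => propext (nbhd_sat h hs e h')) x}

theorem mem_nbhdE {m : ℕ} {s : Fin m → ℝ} {ε : ℝ} (h : Good s ε) (hs : StrictMono s) (e : EE Call)
    (y : PreE Call) : (Quot.mk _ y : EE Call) ∈ nbhdE h hs e ↔ y ∈ nbhd s ε e := Iff.rfl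

theorem nbhdE_open {m : ℕ} {s : Fin m → ℝ} {ε : ℝ} (h : Good s ε) (hs : StrictMono s)
    (e : EE Call) : IsOpen (nbhdE h hs e) := by
  rw [← isQuotientMap_quot_mk.isOpen_preimage]
  exact nbhd_open h e

theorem self_mem_nbhdE {n : ℕ} {ψ : OI} {s : Fin (n + 1) → ℝ} {ε : ℝ} (h : Good s ε)
    (hs : StrictMono s) (hc : (n, ψ) ∈ Call) (hst : s ∈ CFset (n + 1)) :
    qt hc hst ∈ nbhdE h hs (qt hc hst) := by
  refine ⟨id, hst, fun i => ?_, rfl⟩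
  simpa using h.1

theorem isQuotientCoveringMap_pE : IsQuotientCoveringMap pE FF where
  toIsQuotientMap := isQuotientMap_pE
  toContinuousConstSMul := inferInstance
  apply_eq_iff_mem_orbit := pE_eq_iff
  disjoint e := by
    obtain ⟨n, ψ, hc, s, hst, hs, rfl⟩ := exists_strict e
    obtain ⟨ε, hε⟩ := exists_good s
    refine ⟨nbhdE hε hs (qt hc hst),
      (nbhdE_open hε hs _).mem_nhds (self_mem_nbhdE hε hs hc hst), ?_⟩
    rintro g ⟨_, ⟨x, hx, rfl⟩, hx'⟩
    induction x using Quot.ind with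
    | mk y =>
      obtain ⟨κ, h1, h2, h3⟩ := hx
      obtain ⟨κ', h1', h2', h3'⟩ := hx'
      have : κ' = κ := by
        funext i
        exact hε.eq hs (h2' i) (h2 i)
      subst this
      apply smulE_eq_self (e := qt hc hst)
      conv_lhs => rw [← h3]
      exact h3'

/-! ### Filtration -/

/-- Cells of level at most `M`. -/
def CM (M : ℕ) : Set (ℕ × OI) := {c | c ∈ Call ∧ StdAt M c.2⁻¹}

theorem CM_mono {M M' : ℕ} (h : M ≤ M') : CM M ⊆ CM M' := fun _ hc => ⟨hc.1, hc.2.mono h⟩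

theorem CM_step {M : ℕ} {x y : PreE Call} (h : ERel Call x y) (hx : x.1.1 ∈ CM M) :
    y.1.1 ∈ CM (M + 1) := by
  obtain ⟨i, hi, hit, rfl⟩ := h
  refine ⟨hi, ?_⟩
  show StdAt (M + 1) (x.1.1.2 * mi i)⁻¹
  rw [mul_inv_rev]
  exact hx.2.comp (mi_inv_std i)

theorem CM_chain {M : ℕ} {x y : PreE Call} (h : Relation.ReflTransGen Mrg y x)
    (hx : x.1.1 ∈ CM M) : ∃ d, y.1.1.1 = x.1.1.1 + d ∧ y.1.1 ∈ CM (M + d) := by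
  induction h using Relation.ReflTransGen.head_induction_on with
  | refl => exact ⟨0, rfl, hx⟩
  | head hab _ ih =>
    obtain ⟨d, h1, h2⟩ := ih
    refine ⟨d + 1, ?_, CM_step hab h2⟩
    obtain ⟨i, hi, hit, rfl⟩ := hab
    simp only
    omega

theorem card_bound {n m : ℕ} {s : Fin (m + 1) → ℝ} {κ : Fin (n + 1) → Fin (m + 1)}
    (h : s ∘ κ ∈ CFset (n + 1)) : n ≤ 2 * m + 1 := by
  let f : Fin (n / 2 + 1) → Fin (m + 1) := fun l => κ ⟨2 * l, by omega⟩
  have hf : Function.Injective f := by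
    intro a b hab
    by_contra hne
    have hne' : (a : ℕ) ≠ b := fun e => hne (Fin.ext e)
    have hab' : s (f a) = s (f b) := by rw [hab]
    rcases lt_or_gt_of_ne hne' with h1 | h1
    · have := CFset.span h (a := ⟨2 * a, by omega⟩) (b := ⟨2 * b, by omega⟩) (by simp; omega)
      simp only [Function.comp] at this
      change 1 ≤ s (f b) - s (f a) at this
      linarith
    · have := CFset.span h (a := ⟨2 * b, by omega⟩) (b := ⟨2 * a, by omega⟩) (by simp; omega)
      simp only [Function.comp] at this
      change 1 ≤ s (f a) - s (f b) at this
      linarith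
  have := Fintype.card_le_of_injective f hf
  simp only [Fintype.card_fin] at this
  omega

theorem exists_nbhd_CM (e : EE Call) : ∃ U : Set (EE Call), IsOpen U ∧ e ∈ U ∧
    ∃ M, ∀ y : PreE Call, (Quot.mk _ y : EE Call) ∈ U → y.1.1 ∈ CM M := by
  obtain ⟨n, ψ, hc, s, hst, hs, rfl⟩ := exists_strict e
  obtain ⟨ε, hε⟩ := exists_good s
  obtain ⟨M, hM⟩ := hc.std_inv
  refine ⟨nbhdE hε hs (qt hc hst), nbhdE_open hε hs _, self_mem_nbhdE hε hs hc hst,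
    M + (n + 1), ?_⟩
  rintro y ⟨κ, h1, h2, h3⟩
  have := mrg_of_eq_strict (x := pt hc hst) hs h3
  obtain ⟨d, hd1, hd2⟩ := CM_chain (M := M) this ⟨hc, hM⟩
  have := card_bound h1
  simp only at hd1 hd2
  exact CM_mono (by omega) hd2

/-- The map of complexes induced by an inclusion of cells. -/
def incE {C C' : Set (ℕ × OI)} (h : C ⊆ C') : EE C → EE C' :=
  Quot.map (fun x => ⟨⟨x.1.1, h x.1.2⟩, x.2⟩) (by
    rintro x y ⟨i, hc, h, rfl⟩
    exact ⟨i, _, h, rfl⟩)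

theorem incE_qt {C C' : Set (ℕ × OI)} (h : C ⊆ C') {n : ℕ} {ψ : OI} (hc : (n, ψ) ∈ C)
    {t : Fin (n + 1) → ℝ} (ht : t ∈ CFset (n + 1)) : incE h (qt hc ht) = qt (h hc) ht := rfl

theorem continuous_incE {C C' : Set (ℕ × OI)} (h : C ⊆ C') : Continuous (incE h) := by
  refine continuous_quot_lift _ (continuous_quot_mk.comp ?_)
  exact continuous_sigma fun c =>
    continuous_sigmaMk (σ := fun c : C' => CFn (c.1.1 + 1)) (i := ⟨c.1, h c.2⟩)

theorem CM_sub (M : ℕ) : CM M ⊆ Call := fun _ h => h.1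

theorem factor {Z : Type*} [TopologicalSpace Z] [CompactSpace Z] (γ : C(Z, EE Call)) :
    ∃ M, ∃ γ' : C(Z, EE (CM M)), ∀ z, incE (CM_sub M) (γ' z) = γ z := by
  choose U hU hmem Mf hM using exists_nbhd_CM
  obtain ⟨T, hT⟩ := isCompact_univ.elim_finite_subcover (fun e => γ ⁻¹' (U e))
    (fun e => (hU e).preimage γ.continuous) (fun z _ => Set.mem_iUnion.2 ⟨γ z, hmem _⟩)
  let M := T.sup Mf
  let O : Set (EE Call) := ⋃ e ∈ T, U e
  have hO : IsOpen O := isOpen_biUnion fun e _ => hU e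
  have hγ : ∀ z, γ z ∈ O := fun z => by
    have := hT (Set.mem_univ z)
    simpa [O] using this
  have hOM : ∀ y : PreE Call, (Quot.mk _ y : EE Call) ∈ O → y.1.1 ∈ CM M := by
    intro y hy
    simp only [O, Set.mem_iUnion] at hy
    obtain ⟨e, he, hy⟩ := hy
    exact CM_mono (Finset.le_sup (f := Mf) he) (hM e y hy)
  -- the quotient map restricted to the open set
  let q : PreE Call → EE Call := Quot.mk _
  have hq : IsQuotientMap q := isQuotientMap_quot_mk
  have hqO := hq.restrictPreimage_isOpen hO
  let f : q ⁻¹' O → EE (CM M) := fun y => Quot.mk _ ⟨⟨y.1.1.1, hOM y.1 y.2⟩, y.1.2⟩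
  have hf : Continuous f := by
    refine continuous_quot_mk.comp ?_
    have hop : IsOpen (q ⁻¹' O) := hO.preimage hq.continuous
    rw [continuous_iff_continuousAt]
    rintro ⟨⟨c, t⟩, hy⟩
    have hc : c.1 ∈ CM M := hOM _ hy
    -- locally near `y` the map is a cell inclusion
    have hind : IsOpenEmbedding (fun u : CFn (c.1.1 + 1) => (⟨c, u⟩ : PreE Call)) :=
      IsOpenEmbedding.sigmaMk (σ := fun c : Call => CFn (c.1.1 + 1))
    rw [ContinuousAt, hop.isOpenEmbedding_subtypeVal.isInducing.nhds_eq_comap]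
    have h1 : 𝓝 (⟨c, t⟩ : PreE Call) = Filter.map (fun u : CFn (c.1.1 + 1) => (⟨c, u⟩ : PreE Call)) (𝓝 t) :=
      (hind.map_nhds_eq t).symm
    intro W hW
    have h2 : Tendsto (fun u : CFn (c.1.1 + 1) => (⟨⟨c.1, hc⟩, u⟩ : PreE (CM M))) (𝓝 t)
        (𝓝 ⟨⟨c.1, hc⟩, t⟩) :=
      (continuous_sigmaMk (σ := fun c : CM M => CFn (c.1.1 + 1)) (i := ⟨c.1, hc⟩)).tendsto t
    refine Filter.mem_map.2 (Filter.mem_comap.2 ⟨(fun u : CFn (c.1.1 + 1) => (⟨c, u⟩ : PreE Call)) ''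
      ((fun u : CFn (c.1.1 + 1) => (⟨⟨c.1, hc⟩, u⟩ : PreE (CM M))) ⁻¹' W), ?_, ?_⟩)
    · show _ ∈ 𝓝 (⟨c, t⟩ : PreE Call)
      rw [h1]
      exact Filter.image_mem_map (h2 hW)
    · rintro ⟨y, hy'⟩ ⟨u, hu, rfl⟩
      exact hu
  have hfwd : ∀ a b : PreE Call, Relation.EqvGen (ERel Call) a b → ∀ (ha : a ∈ q ⁻¹' O)
      (hb : b ∈ q ⁻¹' O), f ⟨a, ha⟩ = f ⟨b, hb⟩ := by
    intro a b hab
    induction hab with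
    | rel a b h =>
      intro ha hb
      refine Quot.sound ?_
      obtain ⟨i, hc, h, rfl⟩ := h
      exact ⟨i, hOM _ hb, h, rfl⟩
    | refl a => intro _ _; rfl
    | symm a b _ ih => intro ha hb; exact (ih hb ha).symm
    | trans a b c h1 h2 ih1 ih2 =>
      intro ha hc
      have hb : b ∈ q ⁻¹' O := by
        have : q a = q b := Quot.eqvGen_sound h1
        show q b ∈ O
        rw [← this]; exact ha
      exact (ih1 ha hb).trans (ih2 hb hc)
  have hfac : Function.FactorsThrough f (O.restrictPreimage q) := by
    intro a b hab
    exact hfwd _ _ (Quot.eqvGen_exact (congrArg Subtype.val hab)) a.2 b.2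
  let F : C(O, EE (CM M)) := IsQuotientMap.lift (f := ⟨O.restrictPreimage q, hqO.continuous⟩) hqO ⟨f, hf⟩ hfac
  refine ⟨M, F.comp ⟨fun z => ⟨γ z, hγ z⟩, by fun_prop⟩, fun z => ?_⟩
  have hF : ∀ o : O, incE (CM_sub M) (F o) = o.1 := by
    intro o
    obtain ⟨y, rfl⟩ := hqO.surjective o
    have : F (O.restrictPreimage q y) = f y := by
      have := IsQuotientMap.lift_comp (f := ⟨O.restrictPreimage q, hqO.continuous⟩) hqO ⟨f, hf⟩ hfac
      exact congrArg (fun g : C(_, _) => g y) this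
    rw [this]
    rfl
  exact hF _

end

section

open Filter Topology unitInterval

/-! ### Pushing points away from a given one -/

/-- How far the entry `j` is from being isolated. -/
noncomputable def dl {n : ℕ} (j : Fin (n + 1)) (t : Fin (n + 1) → ℝ) : ℝ :=
  ∑ l, if l = j then 0 else max 0 (1 - |t l - t j|)

/-- Push all entries away from the entry `j`. -/
noncomputable def push {n : ℕ} (j : Fin (n + 1)) (τ : ℝ) (t : Fin (n + 1) → ℝ) :
    Fin (n + 1) → ℝ :=
  fun l => if l < j then t l - τ * dl j t else if j < l then t l + τ * dl j t else t l

theorem dl_term_nonneg {n : ℕ} (j : Fin (n + 1)) (t : Fin (n + 1) → ℝ) (l : Fin (n + 1)) :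
    0 ≤ (if l = j then 0 else max 0 (1 - |t l - t j|) : ℝ) := by
  split_ifs
  · exact le_rfl
  · exact le_max_left _ _

theorem dl_nonneg {n : ℕ} (j : Fin (n + 1)) (t : Fin (n + 1) → ℝ) : 0 ≤ dl j t :=
  Finset.sum_nonneg fun l _ => dl_term_nonneg j t l

theorem dl_ge {n : ℕ} {j l : Fin (n + 1)} (t : Fin (n + 1) → ℝ) (h : l ≠ j) :
    1 - |t l - t j| ≤ dl j t := by
  have := Finset.single_le_sum (f := fun l => (if l = j then 0 else max 0 (1 - |t l - t j|) : ℝ))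
    (fun l _ => dl_term_nonneg j t l) (Finset.mem_univ l)
  simp only [if_neg h] at this
  exact (le_max_right _ _).trans this

theorem dl_eq_zero {n : ℕ} {j : Fin (n + 1)} {t : Fin (n + 1) → ℝ}
    (h : dup t j ∈ CFset (n + 2)) : dl j t = 0 := by
  refine Finset.sum_eq_zero fun l _ => ?_
  split_ifs with hl
  · rfl
  · have := CFset.isolated h l hl
    exact max_eq_left (by linarith)

theorem dl_dup {n : ℕ} {i j : Fin (n + 1)} {t : Fin (n + 1) → ℝ} (hij : i ≠ j)
    (h : dup t i ∈ CFset (n + 2)) : dl (iot i j) (dup t i) = dl j t := by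
  unfold dl
  rw [Fin.sum_univ_succAbove _ i.castSucc]
  have h0 : (if i.castSucc = iot i j then 0 else
      max 0 (1 - |dup t i i.castSucc - dup t i (iot i j)|) : ℝ) = 0 := by
    rw [if_neg (Fin.ne_succAbove _ _), dup_self, dup_iot]
    have := CFset.isolated h j hij.symm
    rw [abs_sub_comm] at this
    exact max_eq_left (by linarith)
  rw [h0, zero_add]
  refine Finset.sum_congr rfl fun l _ => ?_
  have e : (i.castSucc.succAbove l = iot i j) ↔ l = j := Fin.succAbove_right_inj
  simp only [e]
  rw [dup_iot t i j, show dup t i (i.castSucc.succAbove l) = t l from dup_iot t i l]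

theorem push_dup {n : ℕ} {i j : Fin (n + 1)} {t : Fin (n + 1) → ℝ} (hij : i ≠ j)
    (h : dup t i ∈ CFset (n + 2)) (τ : ℝ) :
    push (iot i j) τ (dup t i) = dup (push j τ t) i := by
  ext l
  have h' : (i : ℕ) ≠ j := fun e => hij (Fin.ext e)
  rw [dup_apply]
  unfold push
  rw [dl_dup hij h, dup_apply]
  have e1 : l < iot i j ↔ i.predAbove l < j := by
    rw [Fin.lt_def, Fin.lt_def, iot_val, predAbove_val]; split_ifs <;> omega
  have e2 : iot i j < l ↔ j < i.predAbove l := by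
    rw [Fin.lt_def, Fin.lt_def, iot_val, predAbove_val]; split_ifs <;> omega
  simp only [e1, e2]

theorem push_eq_self {n : ℕ} {j : Fin (n + 1)} {t : Fin (n + 1) → ℝ} {τ : ℝ}
    (h : τ * dl j t = 0) : push j τ t = t := by
  ext l; unfold push; rw [h]; simp

theorem push_mem {n : ℕ} (j : Fin (n + 1)) {t : Fin (n + 1) → ℝ} {τ : ℝ}
    (hτ : 0 ≤ τ) (ht : t ∈ CFset (n + 1)) : push j τ t ∈ CFset (n + 1) := by
  have hd : 0 ≤ τ * dl j t := mul_nonneg hτ (dl_nonneg j t)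
  have key : ∀ a b : Fin (n + 1), a < b → t b - t a ≤ push j τ t b - push j τ t a := by
    intro a b hab
    unfold push
    rw [Fin.lt_def] at hab
    simp only [Fin.lt_def]
    split_ifs <;> linarith
  refine CFset.mk (fun a b hab => ?_) (fun a b hab => ?_)
  · have := key a b hab
    have := ht.1 hab.le
    linarith
  · have := key a b (by rw [Fin.lt_def]; omega)
    have := CFset.span ht hab
    linarith

theorem push_one_dup_mem {n : ℕ} (j : Fin (n + 1)) {t : Fin (n + 1) → ℝ}
    (ht : t ∈ CFset (n + 1)) : dup (push j 1 t) j ∈ CFset (n + 2) := by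
  refine CFset.dup_mem (push_mem j zero_le_one ht) fun l hl => ?_
  have h1 := dl_ge t hl
  have hj : push j 1 t j = t j := by unfold push; simp
  rw [hj]
  unfold push
  rcases lt_or_gt_of_ne hl with h | h
  · have := ht.1 h.le
    rw [if_pos h]
    rw [abs_of_nonpos (by linarith)] at h1
    have h2 := neg_le_abs (t l - 1 * dl j t - t j)
    linarith
  · have := ht.1 h.le
    rw [if_neg (not_lt.2 h.le), if_pos h]
    rw [abs_of_nonneg (by linarith)] at h1
    have h2 := le_abs_self (t l + 1 * dl j t - t j)
    linarith

theorem continuous_dl {n : ℕ} (j : Fin (n + 1)) : Continuous (dl j) := by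
  unfold dl
  refine continuous_finsetSum _ fun l _ => ?_
  split_ifs
  · exact continuous_const
  · fun_prop

theorem continuous_push {n : ℕ} (j : Fin (n + 1)) :
    Continuous fun p : (Fin (n + 1) → ℝ) × ℝ => push j p.2 p.1 := by
  have := continuous_dl j
  refine continuous_pi fun l => ?_
  unfold push
  split_ifs <;> fun_prop

/-! ### Interval combinatorics -/

theorem StdAt.int_of {M : ℕ} {φ : OI} (h : StdAt M φ) {x : ℝ} {j : ℤ} (hx : φ x = j) :
    ∃ a : ℤ, x = a / 2 ^ M := by
  obtain ⟨b, k, -, hb⟩ := h ⌊2 ^ M * x⌋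
  have h1 := hb (Int.fract (2 ^ M * x)) (Int.fract_nonneg _) (Int.fract_lt_one _).le
  rw [Int.floor_add_fract, mul_div_cancel_left₀ _ (by positivity), hx] at h1
  rw [eq_div_iff (by positivity)] at h1
  have h2 : Int.fract (2 ^ M * x) = ((j * 2 ^ k - b : ℤ) : ℝ) := by push_cast; linarith
  have h3 : Int.fract (2 ^ M * x) = 0 := by
    rw [← Int.fract_fract, h2, Int.fract_intCast]
  refine ⟨⌊2 ^ M * x⌋, ?_⟩
  rw [eq_div_iff (by positivity)]
  have := Int.floor_add_fract (2 ^ M * x)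
  linarith

theorem StdAt.split {M : ℕ} {φ : OI} (h : StdAt M φ) {a b : ℤ} {j : ℕ}
    (ha : φ (a / 2 ^ M) = j) (hb : φ (b / 2 ^ M) = j + 1) (hab : a + 2 ≤ b) :
    StdAt M ((mi j)⁻¹ * φ) := by
  intro a'
  obtain ⟨b', k, -, hk⟩ := h a'
  have hp : (0 : ℝ) < 2 ^ M := by positivity
  rcases lt_or_ge a' a with h1 | h1
  · refine ⟨b', k, Nat.zero_le _, fun y h0 h1' => ?_⟩
    have h2 : (a' : ℝ) + 1 ≤ a := by exact_mod_cast h1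
    have h3 : φ ((a' + y) / 2 ^ M) ≤ φ (a / 2 ^ M) :=
      φ.monotone (by gcongr; linarith)
    rw [RelIso.mul_apply, mi_inv_apply, if_pos (by rw [← ha]; exact h3), hk y h0 h1']
  rcases lt_or_ge a' b with h2 | h2
  · have h1' : (a : ℝ) ≤ a' := by exact_mod_cast h1
    have h2' : (a' : ℝ) + 1 ≤ b := by exact_mod_cast h2
    have hlo : ∀ y : ℝ, 0 ≤ y → (j : ℝ) ≤ φ ((a' + y) / 2 ^ M) := fun y hy => by
      rw [← ha]; exact φ.monotone (by gcongr; linarith)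
    have hhi : ∀ y : ℝ, y ≤ 1 → φ ((a' + y) / 2 ^ M) ≤ j + 1 := fun y hy => by
      rw [← hb]; exact φ.monotone (by gcongr; linarith)
    have hk1 : k ≠ 0 := by
      rintro rfl
      have l0 := hlo 0 le_rfl
      have l1 := hhi 1 le_rfl
      have e0 := hk 0 le_rfl zero_le_one
      have e1 := hk 1 zero_le_one le_rfl
      simp only [pow_zero, div_one] at e0 e1
      rw [e0] at l0
      rw [e1] at l1
      have ej : (b' : ℝ) = j := by linarith
      have f0 : φ ((a' + 0) / 2 ^ M) = φ (a / 2 ^ M) := by rw [e0, ha, ej]; ring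
      have f1 : φ ((a' + 1) / 2 ^ M) = φ (b / 2 ^ M) := by rw [e1, hb, ej]
      have g0 := φ.injective f0
      have g1 := φ.injective f1
      rw [div_left_inj' hp.ne'] at g0 g1
      have : (b : ℝ) = a + 1 := by linarith
      have : b = a + 1 := by exact_mod_cast this
      omega
    obtain ⟨k', rfl⟩ := Nat.exists_eq_succ_of_ne_zero hk1
    refine ⟨b' - j * 2 ^ k', k', Nat.zero_le _, fun y h0 h1'' => ?_⟩
    have l0 := hlo y h0
    have l1 := hhi y h1''
    have e : (mi j)⁻¹ (φ ((a' + y) / 2 ^ M)) = 2 * φ ((a' + y) / 2 ^ M) - j := by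
      rw [mi_inv_apply]; split_ifs <;> linarith
    rw [RelIso.mul_apply, e, hk y h0 h1'']
    push_cast
    rw [pow_succ]; field_simp; ring
  · refine ⟨b' + 2 ^ k, k, Nat.zero_le _, fun y h0 h1' => ?_⟩
    have h2' : (b : ℝ) ≤ a' := by exact_mod_cast h2
    have h3 : φ (b / 2 ^ M) ≤ φ ((a' + y) / 2 ^ M) :=
      φ.monotone (by gcongr; linarith)
    rw [hb] at h3
    have e : (mi j)⁻¹ (φ ((a' + y) / 2 ^ M)) = φ ((a' + y) / 2 ^ M) + 1 := by
      rw [mi_inv_apply]; split_ifs <;> linarith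
    rw [RelIso.mul_apply, e, hk y h0 h1']
    push_cast
    field_simp; ring

/-- Cells of level `M` all of whose intervals belong to `J`. -/
def CJ (M : ℕ) (J : Finset (ℤ × ℤ)) : Set (ℕ × OI) :=
  {c | c ∈ CM M ∧ ∀ j : ℕ, j ≤ c.1 → ∃ p ∈ J, c.2 j = (p.1 : ℝ) / 2 ^ M ∧
    c.2 (j + 1) = (p.2 : ℝ) / 2 ^ M}

theorem CJ_sub (M : ℕ) (J : Finset (ℤ × ℤ)) : CJ M J ⊆ Call := fun _ h => h.1.1

/-- A family of intervals closed under passing to subintervals. -/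
def Hered (J : Finset (ℤ × ℤ)) : Prop :=
  ∀ p ∈ J, p.1 < p.2 ∧ ∀ a b : ℤ, p.1 ≤ a → a < b → b ≤ p.2 → (a, b) ∈ J

/-- The interval `p` occurs at position `j` of `ψ`. -/
def HasJ (M : ℕ) (p : ℤ × ℤ) (ψ : OI) (j : ℕ) : Prop :=
  ψ j = (p.1 : ℝ) / 2 ^ M ∧ ψ (j + 1) = (p.2 : ℝ) / 2 ^ M

theorem HasJ.unique {M : ℕ} {p : ℤ × ℤ} {ψ : OI} {j j' : ℕ} (h : HasJ M p ψ j)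
    (h' : HasJ M p ψ j') : j = j' := by
  have := ψ.injective (h.1.trans h'.1.symm)
  exact_mod_cast this

theorem HasJ.pair {M : ℕ} {p p' : ℤ × ℤ} {ψ : OI} {j : ℕ} (h : HasJ M p ψ j)
    (h' : HasJ M p' ψ j) : p = p' := by
  have hp : (2 : ℝ) ^ M ≠ 0 := by positivity
  have h1 := h.1.symm.trans h'.1
  have h2 := h.2.symm.trans h'.2
  rw [div_left_inj' hp] at h1 h2
  exact Prod.ext (by exact_mod_cast h1) (by exact_mod_cast h2)

theorem HasJ.mul_lt {M : ℕ} {p : ℤ × ℤ} {ψ : OI} {i j : ℕ} (hij : j < i) :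
    HasJ M p (ψ * mi i) j ↔ HasJ M p ψ j := by
  have h : (j : ℝ) + 1 ≤ i := by exact_mod_cast hij
  unfold HasJ
  rw [RelIso.mul_apply, RelIso.mul_apply, mi_le i (by linarith), mi_le i h]

theorem HasJ.mul_gt {M : ℕ} {p : ℤ × ℤ} {ψ : OI} {i j : ℕ} (hij : i < j) :
    HasJ M p (ψ * mi i) (j + 1) ↔ HasJ M p ψ j := by
  have h : (i : ℝ) + 1 ≤ j := by exact_mod_cast hij
  unfold HasJ
  push_cast
  rw [RelIso.mul_apply, RelIso.mul_apply, mi_ge i (by linarith), mi_ge i (by linarith)]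
  simp

theorem HasJ.mul_iot {M : ℕ} {p : ℤ × ℤ} {ψ : OI} {n : ℕ} {i j : Fin (n + 1)} (hij : i ≠ j) :
    HasJ M p (ψ * mi i) (iot i j : Fin (n + 2)) ↔ HasJ M p ψ j := by
  have h' : (i : ℕ) ≠ j := fun e => hij (Fin.ext e)
  rw [iot_val]
  split_ifs with h
  · exact HasJ.mul_lt h
  · exact HasJ.mul_gt (by omega)

/-- After splitting an interval it no longer occurs. -/
theorem HasJ.not_split {M : ℕ} {p : ℤ × ℤ} {ψ : OI} {i : ℕ} (h : HasJ M p ψ i) (j : ℕ) :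
    ¬ HasJ M p (ψ * mi i) j := by
  intro h'
  have h1 := h'.1
  rw [← h.1, RelIso.mul_apply] at h1
  have h2 := ψ.injective h1
  rw [← mi_le i (le_refl (i : ℝ))] at h2
  have h3 : (j : ℝ) = i := (mi i).injective h2
  have h4 := h'.2
  rw [← h.2, RelIso.mul_apply, h3, mi_mid] at h4
  have h5 := ψ.injective h4
  linarith

/-- A maximal interval cannot be created by splitting. -/
theorem HasJ.of_split {M : ℕ} {J : Finset (ℤ × ℤ)} {p : ℤ × ℤ}
    (hmax : ∀ p' ∈ J, p'.2 - p'.1 ≤ p.2 - p.1) {n : ℕ} {ψ : OI} (hc : (n, ψ) ∈ CJ M J)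
    {i j : ℕ} (hi : i ≤ n) (hj : j ≤ n + 1) (h : HasJ M p (ψ * mi i) j) :
    ∃ j', j' ≤ n ∧ HasJ M p ψ j' := by
  have hp : (0 : ℝ) < 2 ^ M := by positivity
  rcases lt_or_ge j i with h1 | h1
  · exact ⟨j, by omega, (HasJ.mul_lt h1).1 h⟩
  rcases lt_or_ge (i + 1) j with h2 | h2
  · obtain ⟨j', rfl⟩ : ∃ j', j = j' + 1 := ⟨j - 1, by omega⟩
    exact ⟨j', by omega, (HasJ.mul_gt (by omega)).1 h⟩
  exfalso
  obtain ⟨p', hp', e1, e2⟩ := hc.2 i hi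
  have hm := hmax p' hp'
  have hm' : (p'.2 : ℝ) - p'.1 ≤ p.2 - p.1 := by exact_mod_cast hm
  have hc : ψ i < ψ (i + 1 / 2) ∧ ψ (i + 1 / 2) < ψ (i + 1) :=
    ⟨ψ.strictMono (by linarith), ψ.strictMono (by linarith)⟩
  simp only at e1 e2
  rw [eq_div_iff hp.ne'] at e1 e2
  have hlen : (ψ (i + 1) - ψ i) * 2 ^ M ≤ p.2 - p.1 := by linarith
  obtain ⟨g1, g2⟩ := h
  rw [RelIso.mul_apply, eq_div_iff hp.ne'] at g1 g2
  obtain rfl | rfl : j = i ∨ j = i + 1 := by omega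
  · rw [mi_le _ le_rfl] at g1
    rw [mi_mid] at g2
    nlinarith
  · push_cast at g1 g2
    rw [mi_mid] at g1
    rw [mi_ge _ (by linarith)] at g2
    rw [show (i : ℝ) + 1 + 1 - 1 = i + 1 by ring] at g2
    nlinarith

theorem CJ_erase {M : ℕ} {J : Finset (ℤ × ℤ)} {p : ℤ × ℤ} {n : ℕ} {ψ : OI}
    (hc : (n, ψ) ∈ CJ M J) (h : ¬ ∃ j : Fin (n + 1), HasJ M p ψ j) :
    (n, ψ) ∈ CJ M (J.erase p) := by
  refine ⟨hc.1, fun j hj => ?_⟩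
  obtain ⟨p', hp', e⟩ := hc.2 j hj
  refine ⟨p', Finset.mem_erase.2 ⟨?_, hp'⟩, e⟩
  rintro rfl
  exact h ⟨⟨j, Nat.lt_succ_of_le hj⟩, e⟩

theorem CJ_split {M : ℕ} {J : Finset (ℤ × ℤ)} (hJ : Hered J) {p : ℤ × ℤ} (hp : p.1 + 2 ≤ p.2)
    {n : ℕ} {ψ : OI} (hc : (n, ψ) ∈ CJ M J) (i : Fin (n + 1)) (h : HasJ M p ψ i) :
    (n + 1, ψ * mi i) ∈ CJ M (J.erase p) := by
  have hi : (i : ℕ) ≤ n := Nat.lt_succ_iff.1 i.2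
  have hpos : (0 : ℝ) < 2 ^ M := by positivity
  have hstd : StdAt M (ψ * mi i)⁻¹ := by
    rw [mul_inv_rev]
    refine StdAt.split hc.1.2 (a := p.1) (b := p.2) ?_ ?_ hp
    · rw [← h.1, RelIso.inv_apply_self]
    · rw [← h.2, RelIso.inv_apply_self]
  have hJ' : ∀ j : ℕ, j ≤ n + 1 → ∃ p' ∈ J, HasJ M p' (ψ * mi i) j := by
    intro j hj
    rcases lt_or_ge j i with h1 | h1
    · obtain ⟨p', hp', e⟩ := hc.2 j (by simp only; omega)
      exact ⟨p', hp', (HasJ.mul_lt h1).2 e⟩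
    rcases lt_or_ge ((i : ℕ) + 1) j with h2 | h2
    · obtain ⟨j', rfl⟩ : ∃ j', j = j' + 1 := ⟨j - 1, by omega⟩
      obtain ⟨p', hp', e⟩ := hc.2 j' (by simp only; omega)
      exact ⟨p', hp', (HasJ.mul_gt (by omega)).2 e⟩
    have hpJ : p ∈ J := by
      obtain ⟨p', hp', e⟩ := hc.2 i hi
      rwa [HasJ.pair h e]
    obtain ⟨c, hcc⟩ := hstd.int_of (x := ψ (i + 1 / 2)) (j := (i : ℕ) + 1) (by
      rw [← mi_mid, ← RelIso.mul_apply ψ, RelIso.inv_apply_self]; push_cast; rfl)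
    have hlt : ψ i < ψ (i + 1 / 2) ∧ ψ (i + 1 / 2) < ψ (i + 1) :=
      ⟨ψ.strictMono (by linarith), ψ.strictMono (by linarith)⟩
    rw [hcc, h.1, h.2, div_lt_div_iff_of_pos_right hpos, div_lt_div_iff_of_pos_right hpos] at hlt
    have hl1 : p.1 < c := by exact_mod_cast hlt.1
    have hl2 : c < p.2 := by exact_mod_cast hlt.2
    obtain rfl | rfl : j = i ∨ j = i + 1 := by omega
    · refine ⟨(p.1, c), (hJ p hpJ).2 _ _ le_rfl hl1 hl2.le, ?_, ?_⟩
      · rw [RelIso.mul_apply, mi_le _ le_rfl, h.1]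
      · rw [RelIso.mul_apply, mi_mid, hcc]
    · refine ⟨(c, p.2), (hJ p hpJ).2 _ _ hl1.le hl2 le_rfl, ?_, ?_⟩
      · push_cast
        rw [RelIso.mul_apply, mi_mid, hcc]
      · push_cast
        rw [RelIso.mul_apply, mi_ge _ (by linarith),
          show ((i : ℕ) : ℝ) + 1 + 1 - 1 = (i : ℕ) + 1 by ring, h.2]
  refine ⟨⟨InV.mul_mi hc.1.1 hi, hstd⟩, fun j hj => ?_⟩
  obtain ⟨p', hp', e⟩ := hJ' j hj
  refine ⟨p', Finset.mem_erase.2 ⟨?_, hp'⟩, e⟩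
  rintro rfl
  exact h.not_split j e

theorem Hered.erase {J : Finset (ℤ × ℤ)} (hJ : Hered J) {p : ℤ × ℤ}
    (hmax : ∀ p' ∈ J, p'.2 - p'.1 ≤ p.2 - p.1) : Hered (J.erase p) := by
  intro p' hp0
  obtain ⟨hne, hp'⟩ := Finset.mem_erase.1 hp0
  clear hp0
  refine ⟨(hJ p' hp').1, fun a b h1 h2 h3 => Finset.mem_erase.2 ⟨?_, (hJ p' hp').2 a b h1 h2 h3⟩⟩
  rintro rfl
  apply hne
  have := hmax p' hp'
  simp only at this
  exact Prod.ext (by simp only; omega) (by simp only; omega)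

end

section

open Filter Topology unitInterval

theorem qt_congr {C : Set (ℕ × OI)} {n : ℕ} {ψ : OI} (hc : (n, ψ) ∈ C) {t t' : Fin (n + 1) → ℝ}
    (ht : t ∈ CFset (n + 1)) (ht' : t' ∈ CFset (n + 1)) (e : t = t') : qt hc ht = qt hc ht' := by
  subst e; rfl

theorem homotopy_lift {C : Set (ℕ × OI)} {Y : Type*} [TopologicalSpace Y] (G : PreE C → I → Y)
    (hG : ∀ c : C, Continuous fun p : CFn (c.1.1 + 1) × I => G ⟨c, p.1⟩ p.2)
    (hR : ∀ x y, ERel C x y → ∀ τ, G x τ = G y τ) :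
    ∃ H : C(I × EE C, Y), ∀ τ x, H (τ, Quot.mk _ x) = G x τ := by
  refine ⟨⟨fun p => Quot.lift (fun x => G x p.1) (fun x y h => hR x y h p.1) p.2, ?_⟩,
    fun _ _ => rfl⟩
  refine IsQuotientMap.continuous_lift_prod_right (f := (Quot.mk (ERel C))) isQuotientMap_quot_mk ?_
  show Continuous fun p : I × PreE C => G p.2 p.1
  have h1 : Continuous fun p : PreE C × I => G p.1 p.2 := by
    have : Continuous (fun q : (c : C) × (CFn (c.1.1 + 1) × I) => G ⟨q.1, q.2.1⟩ q.2.2) :=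
      continuous_sigma fun c => hG c
    exact this.comp (Homeomorph.sigmaProdDistrib (X := fun c : C => CFn (c.1.1 + 1)) (Y := I)).continuous
  exact h1.comp continuous_swap

theorem continuous_cell {C : Set (ℕ × OI)} (c : C) :
    Continuous fun t : CFn (c.1.1 + 1) => (Quot.mk _ ⟨c, t⟩ : EE C) :=
  continuous_quot_mk.comp (@continuous_sigmaMk C (fun c : C => CFn (c.1.1 + 1)) _ c)

open Classical in
/-- The pushing homotopy on cells. -/
noncomputable def Gp (M : ℕ) (J : Finset (ℤ × ℤ)) (p : ℤ × ℤ) (x : PreE (CJ M J)) (τ : I) :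
    EE Call :=
  if h : ∃ j : Fin (x.1.1.1 + 1), HasJ M p x.1.1.2 j then
    qt (C := Call) (CJ_sub M J x.1.2) (push_mem h.choose τ.2.1 x.2.2)
  else qt (C := Call) (CJ_sub M J x.1.2) x.2.2

theorem Gp_pos {M : ℕ} {J : Finset (ℤ × ℤ)} {p : ℤ × ℤ} {n : ℕ} {ψ : OI} (hc : (n, ψ) ∈ CJ M J)
    {t : Fin (n + 1) → ℝ} (ht : t ∈ CFset (n + 1)) {j : Fin (n + 1)} (h : HasJ M p ψ j) (τ : I) :
    Gp M J p (pt hc ht) τ = qt (CJ_sub M J hc) (push_mem j τ.2.1 ht) := by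
  have hh : ∃ j : Fin (n + 1), HasJ M p ψ j := ⟨j, h⟩
  have e : hh.choose = j := Fin.ext (hh.choose_spec.unique h)
  unfold Gp
  rw [dif_pos hh]
  exact qt_congr _ _ _ (by rw [← e])

theorem Gp_neg {M : ℕ} {J : Finset (ℤ × ℤ)} {p : ℤ × ℤ} {n : ℕ} {ψ : OI} (hc : (n, ψ) ∈ CJ M J)
    {t : Fin (n + 1) → ℝ} (ht : t ∈ CFset (n + 1)) (h : ¬ ∃ j : Fin (n + 1), HasJ M p ψ j) (τ : I) :
    Gp M J p (pt hc ht) τ = qt (CJ_sub M J hc) ht := by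
  unfold Gp
  rw [dif_neg h]

open Classical in
/-- The retraction on cells. -/
noncomputable def Rp (M : ℕ) {J : Finset (ℤ × ℤ)} (hJ : Hered J) {p : ℤ × ℤ} (hp : p.1 + 2 ≤ p.2)
    (x : PreE (CJ M J)) : EE (CJ M (J.erase p)) :=
  if h : ∃ j : Fin (x.1.1.1 + 1), HasJ M p x.1.1.2 j then
    qt (CJ_split hJ hp x.1.2 h.choose h.choose_spec) (push_one_dup_mem h.choose x.2.2)
  else qt (CJ_erase x.1.2 h) x.2.2

theorem Rp_pos {M : ℕ} {J : Finset (ℤ × ℤ)} (hJ : Hered J) {p : ℤ × ℤ} (hp : p.1 + 2 ≤ p.2)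
    {n : ℕ} {ψ : OI} (hc : (n, ψ) ∈ CJ M J)
    {t : Fin (n + 1) → ℝ} (ht : t ∈ CFset (n + 1)) {j : Fin (n + 1)} (h : HasJ M p ψ j) :
    Rp M hJ hp (pt hc ht) = qt (CJ_split hJ hp hc j h) (push_one_dup_mem j ht) := by
  have hh : ∃ j : Fin (n + 1), HasJ M p ψ j := ⟨j, h⟩
  have e : hh.choose = j := Fin.ext (hh.choose_spec.unique h)
  unfold Rp
  rw [dif_pos hh]
  have key : ∀ (j' : Fin (n + 1)) (h' : HasJ M p ψ j'), j' = j →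
      qt (CJ_split hJ hp hc j' h') (push_one_dup_mem j' ht) =
      qt (CJ_split hJ hp hc j h) (push_one_dup_mem j ht) := by
    rintro j' h' rfl; rfl
  exact key _ hh.choose_spec e

theorem Rp_neg {M : ℕ} {J : Finset (ℤ × ℤ)} (hJ : Hered J) {p : ℤ × ℤ} (hp : p.1 + 2 ≤ p.2)
    {n : ℕ} {ψ : OI} (hc : (n, ψ) ∈ CJ M J)
    {t : Fin (n + 1) → ℝ} (ht : t ∈ CFset (n + 1)) (h : ¬ ∃ j : Fin (n + 1), HasJ M p ψ j) :
    Rp M hJ hp (pt hc ht) = qt (CJ_erase hc h) ht := by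
  unfold Rp
  rw [dif_neg h]

theorem Gp_cont (M : ℕ) (J : Finset (ℤ × ℤ)) (p : ℤ × ℤ) (c : CJ M J) :
    Continuous fun q : CFn (c.1.1 + 1) × I => Gp M J p ⟨c, q.1⟩ q.2 := by
  obtain ⟨⟨n, ψ⟩, hc⟩ := c
  by_cases h : ∃ j : Fin (n + 1), HasJ M p ψ j
  · obtain ⟨j, hj⟩ := h
    have e : (fun q : CFn (n + 1) × I => Gp M J p ⟨⟨(n, ψ), hc⟩, q.1⟩ q.2) =
        fun q : CFn (n + 1) × I => qt (CJ_sub M J hc) (push_mem j q.2.2.1 q.1.2) :=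
      funext fun q => Gp_pos hc q.1.2 hj q.2
    rw [e]
    refine (continuous_cell (C := Call) ⟨(n, ψ), CJ_sub M J hc⟩).comp
      (Continuous.subtype_mk ?_ _)
    exact (continuous_push j).comp
      ((continuous_subtype_val.comp continuous_fst).prodMk
        (continuous_subtype_val.comp continuous_snd))
  · have e : (fun q : CFn (n + 1) × I => Gp M J p ⟨⟨(n, ψ), hc⟩, q.1⟩ q.2) =
        fun q : CFn (n + 1) × I => qt (CJ_sub M J hc) q.1.2 :=
      funext fun q => Gp_neg hc q.1.2 h q.2
    rw [e]
    exact (continuous_cell (C := Call) ⟨(n, ψ), CJ_sub M J hc⟩).comp continuous_fst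

theorem Rp_cont (M : ℕ) {J : Finset (ℤ × ℤ)} (hJ : Hered J) {p : ℤ × ℤ} (hp : p.1 + 2 ≤ p.2)
    (c : CJ M J) : Continuous fun q : CFn (c.1.1 + 1) => Rp M hJ hp ⟨c, q⟩ := by
  obtain ⟨⟨n, ψ⟩, hc⟩ := c
  by_cases h : ∃ j : Fin (n + 1), HasJ M p ψ j
  · obtain ⟨j, hj⟩ := h
    have e : (fun q : CFn (n + 1) => Rp M hJ hp ⟨⟨(n, ψ), hc⟩, q⟩) =
        fun q : CFn (n + 1) => qt (CJ_split hJ hp hc j hj) (push_one_dup_mem j q.2) :=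
      funext fun q => Rp_pos hJ hp hc q.2 hj
    rw [e]
    refine (continuous_cell ⟨(n + 1, ψ * mi j), CJ_split hJ hp hc j hj⟩).comp
      (Continuous.subtype_mk ?_ _)
    have h1 : Continuous fun q : CFn (n + 1) => push j 1 q.1 := (continuous_push j).comp
      (continuous_subtype_val.prodMk continuous_const)
    refine continuous_pi fun l => ?_
    simp only [dup_apply]
    exact (continuous_apply (j.predAbove l)).comp h1
  · have e : (fun q : CFn (n + 1) => Rp M hJ hp ⟨⟨(n, ψ), hc⟩, q⟩) =
        fun q : CFn (n + 1) => qt (CJ_erase hc h) q.2 :=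
      funext fun q => Rp_neg hJ hp hc q.2 h
    rw [e]
    exact continuous_cell ⟨(n, ψ), CJ_erase hc h⟩

theorem Gp_rel {M : ℕ} {J : Finset (ℤ × ℤ)} {p : ℤ × ℤ}
    (hmax : ∀ p' ∈ J, p'.2 - p'.1 ≤ p.2 - p.1) (x y : PreE (CJ M J)) (h : ERel _ x y) (τ : I) :
    Gp M J p x τ = Gp M J p y τ := by
  obtain ⟨⟨⟨n, ψ⟩, hc⟩, ⟨t, ht⟩⟩ := x
  obtain ⟨i, hc', ht', rfl⟩ := h
  simp only at i hc' ht'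
  by_cases h : ∃ j : Fin (n + 1), HasJ M p ψ j
  · obtain ⟨j, hj⟩ := h
    refine (Gp_pos hc ht hj τ).trans ?_
    by_cases hij : i = j
    · subst hij
      refine Eq.trans ?_ (Gp_neg hc' ht' (fun ⟨l, hl⟩ => hj.not_split l hl) τ).symm
      refine qt_step _ _ i _ _ rfl ?_
      rw [push_eq_self]
      rw [dl_eq_zero ht', mul_zero]
    · refine Eq.trans ?_ (Gp_pos hc' ht' ((HasJ.mul_iot hij).2 hj) τ).symm
      exact qt_step _ _ i _ _ rfl (push_dup hij ht' τ)
  · refine (Gp_neg hc ht h τ).trans (Eq.trans ?_ (Gp_neg hc' ht' ?_ τ).symm)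
    · exact qt_step _ _ i _ _ rfl rfl
    · rintro ⟨l, hl⟩
      obtain ⟨j', h1, h2⟩ := HasJ.of_split hmax hc (Nat.lt_succ_iff.1 i.2) (Nat.lt_succ_iff.1 l.2) hl
      exact h ⟨⟨j', by omega⟩, h2⟩

theorem Rp_rel {M : ℕ} {J : Finset (ℤ × ℤ)} (hJ : Hered J) {p : ℤ × ℤ} (hp : p.1 + 2 ≤ p.2)
    (hmax : ∀ p' ∈ J, p'.2 - p'.1 ≤ p.2 - p.1) (x y : PreE (CJ M J)) (h : ERel _ x y) :
    Rp M hJ hp x = Rp M hJ hp y := by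
  obtain ⟨⟨⟨n, ψ⟩, hc⟩, ⟨t, ht⟩⟩ := x
  obtain ⟨i, hc', ht', rfl⟩ := h
  simp only at i hc' ht'
  by_cases h : ∃ j : Fin (n + 1), HasJ M p ψ j
  · obtain ⟨j, hj⟩ := h
    refine (Rp_pos hJ hp hc ht hj).trans ?_
    by_cases hij : i = j
    · subst hij
      refine Eq.trans ?_ (Rp_neg hJ hp hc' ht' (fun ⟨l, hl⟩ => hj.not_split l hl)).symm
      refine qt_congr _ _ _ ?_
      rw [push_eq_self]
      rw [dl_eq_zero ht', mul_zero]
    · refine Eq.trans ?_ (Rp_pos hJ hp hc' ht' ((HasJ.mul_iot hij).2 hj)).symm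
      refine qt_step _ _ (iot j i) _ _ ?_ ?_
      · rw [mul_assoc, mul_assoc, mi_iot hij]
      · rw [push_dup hij ht', dup_dup _ hij]
  · refine (Rp_neg hJ hp hc ht h).trans (Eq.trans ?_ (Rp_neg hJ hp hc' ht' ?_).symm)
    · exact qt_step _ _ i _ _ rfl rfl
    · rintro ⟨l, hl⟩
      obtain ⟨j', h1, h2⟩ := HasJ.of_split hmax hc (Nat.lt_succ_iff.1 i.2) (Nat.lt_succ_iff.1 l.2) hl
      exact h ⟨⟨j', by omega⟩, h2⟩

/-- The inclusion of a subcomplex. -/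
def inJ (M : ℕ) (J : Finset (ℤ × ℤ)) : C(EE (CJ M J), EE Call) :=
  ⟨incE (CJ_sub M J), continuous_incE _⟩

theorem null_step {M : ℕ} {J : Finset (ℤ × ℤ)} (hJ : Hered J) {p : ℤ × ℤ} (hp : p.1 + 2 ≤ p.2)
    (hmax : ∀ p' ∈ J, p'.2 - p'.1 ≤ p.2 - p.1) :
    ∃ ρ : C(EE (CJ M J), EE (CJ M (J.erase p))),
      (inJ M J).Homotopic ((inJ M (J.erase p)).comp ρ) := by
  obtain ⟨H, hH⟩ := homotopy_lift (Gp M J p) (Gp_cont M J p) (fun x y h τ => Gp_rel hmax x y h τ)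
  refine ⟨⟨Quot.lift (Rp M hJ hp) (Rp_rel hJ hp hmax), ?_⟩, ⟨⟨H, ?_, ?_⟩⟩⟩
  · exact continuous_quot_lift _ (continuous_sigma fun c => Rp_cont M hJ hp c)
  · rintro ⟨⟨⟨n, ψ⟩, hc⟩, ⟨t, ht⟩⟩
    refine (hH 0 _).trans ?_
    by_cases h : ∃ j : Fin (n + 1), HasJ M p ψ j
    · obtain ⟨j, hj⟩ := h
      refine (Gp_pos hc ht hj 0).trans (qt_congr _ _ _ (push_eq_self ?_))
      simp
    · exact Gp_neg hc ht h 0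
  · rintro ⟨⟨⟨n, ψ⟩, hc⟩, ⟨t, ht⟩⟩
    refine (hH 1 _).trans ?_
    show _ = inJ M (J.erase p) (Rp M hJ hp (pt hc ht))
    by_cases h : ∃ j : Fin (n + 1), HasJ M p ψ j
    · obtain ⟨j, hj⟩ := h
      rw [Rp_pos hJ hp hc ht hj]
      refine (Gp_pos hc ht hj 1).trans ?_
      exact qt_step _ _ j _ (push_one_dup_mem j ht) rfl rfl
    · rw [Rp_neg hJ hp hc ht h]
      exact Gp_neg hc ht h 1


theorem base_cell {M : ℕ} {J : Finset (ℤ × ℤ)} (hJ : Hered J)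
    (h1 : ∀ p ∈ J, ¬ p.1 + 2 ≤ p.2) {n : ℕ} {ψ : OI} (hc : (n, ψ) ∈ CJ M J) :
    n + 1 = 2 ^ M ∧ ∀ x : ℝ, 0 ≤ x → x ≤ 1 → ψ⁻¹ x = 2 ^ M * x := by
  have hpos : (0 : ℝ) < 2 ^ M := by positivity
  have hV : InV (n + 1) ψ := CJ_sub M J hc
  have key : ∀ j : ℕ, j ≤ n + 1 → ψ j = (j : ℝ) / 2 ^ M := by
    intro j
    induction j with
    | zero => intro _; rw [hV.left _ (by simp)]; simp
    | succ j ih =>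
      intro hj
      obtain ⟨p, hp, e1, e2⟩ := hc.2 j (show j ≤ n by omega)
      have e1 : ψ j = (p.1 : ℝ) / 2 ^ M := e1
      have e2 : ψ (j + 1) = (p.2 : ℝ) / 2 ^ M := e2
      have h3 := (hJ p hp).1
      have h4 := h1 p hp
      have h5 : p.2 = p.1 + 1 := by omega
      have h6 := ih (by omega)
      rw [e1, div_left_inj' hpos.ne'] at h6
      push_cast
      rw [e2, h5]
      push_cast
      rw [h6]
  have e0 : n + 1 = 2 ^ M := by
    have h2 := key (n + 1) le_rfl
    rw [hV.right _ le_rfl] at h2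
    rw [eq_div_iff hpos.ne'] at h2
    have h3 : ((n + 1 : ℕ) : ℝ) = 2 ^ M := by linarith
    exact_mod_cast h3
  refine ⟨e0, fun x hx0 hx1 => ?_⟩
  have hinv : ∀ j : ℕ, j ≤ n + 1 → ψ⁻¹ ((j : ℝ) / 2 ^ M) = j := by
    intro j hj
    rw [← key j hj, RelIso.inv_apply_self]
  rcases hx1.eq_or_lt with rfl | hx1
  · rw [hV.inv_apply le_rfl, mul_one]
    have : ((n + 1 : ℕ) : ℝ) = 2 ^ M := by rw [e0]; push_cast; rfl
    linarith
  · set a : ℕ := ⌊2 ^ M * x⌋₊ with ha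
    have ha0 : (a : ℝ) ≤ 2 ^ M * x := Nat.floor_le (by positivity)
    have ha1 : 2 ^ M * x < a + 1 := Nat.lt_floor_add_one _
    have ha2 : a + 1 ≤ n + 1 := by
      rw [e0]
      have : (a : ℝ) < 2 ^ M := by nlinarith
      have : a < 2 ^ M := by exact_mod_cast this
      omega
    obtain ⟨b, k, -, hk⟩ := hc.1.2 (a : ℤ)
    have hk : ∀ y : ℝ, 0 ≤ y → y ≤ 1 → ψ⁻¹ (((a : ℤ) + y) / 2 ^ M) = (b + y) / 2 ^ k := hk
    have k0 := hk 0 le_rfl zero_le_one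
    have k1 := hk 1 zero_le_one le_rfl
    have k2 := hk (2 ^ M * x - a) (by linarith) (by linarith)
    have i0 := hinv a (by omega)
    have i1 := hinv (a + 1) ha2
    push_cast at k0 k1 k2 i0 i1
    rw [add_zero, add_zero, i0] at k0
    rw [i1] at k1
    have hk0 : (0 : ℝ) < 2 ^ k := by positivity
    rw [eq_div_iff hk0.ne'] at k0 k1
    have e2 : (2 : ℝ) ^ k = 1 := by linarith
    rw [e2] at k0 k1 k2
    have e3 : ((a : ℝ) + (2 ^ M * x - a)) / 2 ^ M = x := by field_simp; ring
    rw [e3] at k2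
    rw [k2]; linarith

theorem base_unique {M : ℕ} {J : Finset (ℤ × ℤ)} (hJ : Hered J)
    (h1 : ∀ p ∈ J, ¬ p.1 + 2 ≤ p.2) {c c' : ℕ × OI} (hc : c ∈ CJ M J) (hc' : c' ∈ CJ M J) :
    c = c' := by
  obtain ⟨n, ψ⟩ := c
  obtain ⟨n', ψ'⟩ := c'
  obtain ⟨e, h⟩ := base_cell hJ h1 hc
  obtain ⟨e', h'⟩ := base_cell hJ h1 hc'
  obtain rfl : n = n' := by omega
  have hV : InV (n + 1) ψ := CJ_sub M J hc
  have hV' : InV (n + 1) ψ' := CJ_sub M J hc'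
  have : ψ⁻¹ = ψ'⁻¹ := by
    refine RelIso.ext fun x => ?_
    rcases le_total x 0 with h0 | h0
    · rw [hV.inv_apply_left h0, hV'.inv_apply_left h0]
    · rcases le_total x 1 with h2 | h2
      · rw [h x h0 h2, h' x h0 h2]
      · rw [hV.inv_apply h2, hV'.inv_apply h2]
  rw [inv_injective this]

theorem CFset_line {n : ℕ} {t u : Fin n → ℝ} (ht : t ∈ CFset n) (hu : u ∈ CFset n) (τ : I) :
    (fun l => (1 - (τ : ℝ)) * t l + τ * u l) ∈ CFset n := by
  have h0 := τ.2.1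
  have h1 : 0 ≤ 1 - (τ : ℝ) := by linarith [τ.2.2]
  refine ⟨fun a b hab => ?_, fun i hi => ?_⟩
  · have := mul_le_mul_of_nonneg_left (ht.1 hab) h1
    have := mul_le_mul_of_nonneg_left (hu.1 hab) h0
    simp only
    linarith
  · have := mul_le_mul_of_nonneg_left (ht.2 i hi) h1
    have := mul_le_mul_of_nonneg_left (hu.2 i hi) h0
    simp only
    linarith

theorem CFset_std (n : ℕ) : (fun l : Fin n => ((l : ℕ) : ℝ)) ∈ CFset n := by
  refine ⟨fun a b hab => ?_, fun i hi => ?_⟩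
  · show ((a : ℕ) : ℝ) ≤ ((b : ℕ) : ℝ)
    exact_mod_cast hab
  · simp only
    push_cast
    linarith

theorem null_base {M : ℕ} {J : Finset (ℤ × ℤ)} (hJ : Hered J)
    (h1 : ∀ p ∈ J, ¬ p.1 + 2 ≤ p.2) : (inJ M J).Nullhomotopic := by
  obtain ⟨H, hH⟩ := homotopy_lift (C := CJ M J) (Y := EE Call)
    (fun x τ => qt (C := Call) (CJ_sub M J x.1.2) (CFset_line x.2.2 (CFset_std _) τ)) (by
      intro c
      obtain ⟨⟨n, ψ⟩, hc⟩ := c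
      refine (continuous_cell (C := Call) ⟨(n, ψ), CJ_sub M J hc⟩).comp
        (continuous_induced_rng.2 ?_)
      refine continuous_pi fun l => ?_
      show Continuous fun p : CFn (n + 1) × I => (1 - (p.2 : ℝ)) * p.1.1 l + p.2 * ((l : ℕ) : ℝ)
      have : Continuous fun p : CFn (n + 1) × I => p.1.1 l :=
        (continuous_apply l).comp (continuous_subtype_val.comp continuous_fst)
      fun_prop) (by
      rintro x y ⟨i, hi, -, rfl⟩ τ
      have := congrArg Prod.fst (base_unique hJ h1 x.1.2 hi)
      simp at this)
  rcases isEmpty_or_nonempty (CJ M J) with he | ⟨⟨c, hc⟩⟩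
  · have : IsEmpty (EE (CJ M J)) := ⟨fun x => by
      induction x using Quot.ind with
      | mk x => exact he.elim x.1⟩
    refine ⟨qt (C := Call) (n := 0) (ψ := 1) InV.one (CFset_std 1), ?_⟩
    have : inJ M J = ContinuousMap.const _ (qt (C := Call) (n := 0) (ψ := 1) InV.one
      (CFset_std 1)) := ContinuousMap.ext fun x => this.elim x
    rw [this]
  · refine ⟨qt (C := Call) (n := c.1) (ψ := c.2) (CJ_sub M J hc) (CFset_std (c.1 + 1)), ⟨⟨H, ?_, ?_⟩⟩⟩
    · rintro ⟨⟨⟨n, ψ⟩, hc'⟩, ⟨t, ht⟩⟩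
      refine (hH 0 _).trans (qt_congr _ _ _ ?_)
      ext l; simp
    · rintro ⟨⟨⟨n, ψ⟩, hc'⟩, ⟨t, ht⟩⟩
      obtain rfl := base_unique hJ h1 hc hc'
      refine (hH 1 _).trans (qt_congr _ _ _ ?_)
      ext l; simp

theorem null_CJ (M : ℕ) (J : Finset (ℤ × ℤ)) : Hered J → (inJ M J).Nullhomotopic := by
  induction J using Finset.strongInduction with
  | H J ih =>
    intro hJ
    by_cases h : ∃ p ∈ J, p.1 + 2 ≤ p.2
    · obtain ⟨p0, hp0, hp0'⟩ := h
      obtain ⟨p, hp, hmax⟩ := Finset.exists_max_image J (fun p => p.2 - p.1) ⟨p0, hp0⟩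
      have hp2 : p.1 + 2 ≤ p.2 := by have := hmax p0 hp0; omega
      obtain ⟨ρ, hρ⟩ := null_step (M := M) hJ hp2 hmax
      obtain ⟨y, hy⟩ := (ih (J.erase p) (Finset.erase_ssubset hp) (hJ.erase hmax)).comp_left ρ
      exact ⟨y, hρ.trans hy⟩
    · push Not at h
      exact null_base hJ fun p hp => not_le.2 (h p hp)

/-- All dyadic intervals of level `M` in the unit interval. -/
noncomputable def JM (M : ℕ) : Finset (ℤ × ℤ) :=
  ((Finset.Icc 0 (2 ^ M)) ×ˢ (Finset.Icc 0 (2 ^ M))).filter fun p => p.1 < p.2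

theorem hered_JM (M : ℕ) : Hered (JM M) := by
  intro p hp
  simp only [JM, Finset.mem_filter, Finset.mem_product, Finset.mem_Icc] at hp ⊢
  refine ⟨hp.2, fun a b h1 h2 h3 => ?_⟩
  refine ⟨⟨⟨?_, ?_⟩, ?_, ?_⟩, h2⟩ <;> linarith [hp.1.1.1, hp.1.1.2, hp.1.2.1, hp.1.2.2]

theorem CM_JM (M : ℕ) : CM M ⊆ CJ M (JM M) := by
  rintro ⟨n, ψ⟩ hc
  have hV : InV (n + 1) ψ := hc.1
  have hpos : (0 : ℝ) < 2 ^ M := by positivity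
  refine ⟨hc, fun j hj => ?_⟩
  have hj : j ≤ n := hj
  have key : ∀ l : ℕ, l ≤ n + 1 → ∃ a : ℤ, ψ l = a / 2 ^ M ∧ 0 ≤ a ∧ a ≤ 2 ^ M := by
    intro l hl
    obtain ⟨a, ha⟩ := StdAt.int_of hc.2 (x := ψ l) (j := (l : ℤ))
      ((RelIso.inv_apply_self ψ _).trans (by simp))
    refine ⟨a, ha, ?_, ?_⟩
    · have h0 : ψ 0 ≤ ψ l := ψ.monotone (by positivity)
      rw [hV.left 0 le_rfl, ha, le_div_iff₀ hpos, zero_mul] at h0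
      exact_mod_cast h0
    · have h0 : ψ l ≤ ψ ((n + 1 : ℕ) : ℝ) := ψ.monotone (by exact_mod_cast hl)
      rw [hV.right _ le_rfl, ha, div_le_iff₀ hpos] at h0
      have : (a : ℝ) ≤ 2 ^ M := by linarith
      exact_mod_cast this
  obtain ⟨a, ha, ha0, ha1⟩ := key j (by omega)
  obtain ⟨b, hb, hb0, hb1⟩ := key (j + 1) (by omega)
  push_cast at hb
  have hlt : ψ j < ψ (j + 1) := ψ.strictMono (by linarith)
  rw [ha, hb, div_lt_div_iff_of_pos_right hpos] at hlt
  refine ⟨(a, b), ?_, ha, hb⟩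
  simp only [JM, Finset.mem_filter, Finset.mem_product, Finset.mem_Icc]
  exact ⟨⟨⟨ha0, ha1⟩, hb0, hb1⟩, by exact_mod_cast hlt⟩

theorem null_all {Z : Type*} [TopologicalSpace Z] [CompactSpace Z] (γ : C(Z, EE Call)) :
    γ.Nullhomotopic := by
  obtain ⟨M, γ', h⟩ := factor γ
  have e : γ = (inJ M (JM M)).comp ((⟨incE (CM_JM M), continuous_incE _⟩ : C(_, _)).comp γ') := by
    ext z
    rw [← h z]
    show _ = incE (CJ_sub M (JM M)) (incE (CM_JM M) (γ' z))
    generalize γ' z = w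
    induction w using Quot.ind
    rfl
  rw [e]
  exact (null_CJ M _ (hered_JM M)).comp_left _

end

section

open Filter Topology unitInterval

/-- A bump function on the cube. -/
noncomputable def bump {N : Type} [Fintype N] (s : N → I) : ℝ :=
  ∏ i, (min 1 (4 * (s i : ℝ)) * min 1 (4 * (1 - (s i : ℝ))))

theorem bump_cont {N : Type} [Fintype N] : Continuous (bump (N := N)) := by
  unfold bump
  fun_prop

theorem bump_mem {N : Type} [Fintype N] (s : N → I) : bump s ∈ Set.Icc (0 : ℝ) 1 := by
  have h0 : ∀ i, 0 ≤ min 1 (4 * (s i : ℝ)) * min 1 (4 * (1 - (s i : ℝ))) := fun i =>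
    mul_nonneg (le_min zero_le_one (by linarith [(s i).2.1]))
      (le_min zero_le_one (by linarith [(s i).2.2]))
  refine ⟨Finset.prod_nonneg fun i _ => h0 i, Finset.prod_le_one (fun i _ => h0 i) fun i _ => ?_⟩
  exact mul_le_one₀ (min_le_left _ _) (le_min zero_le_one (by linarith [(s i).2.2]))
    (min_le_left _ _)

theorem bump_boundary {N : Type} [Fintype N] {s : N → I} (h : s ∈ Cube.boundary N) :
    bump s = 0 := by
  obtain ⟨i, hi⟩ := h
  refine Finset.prod_eq_zero (Finset.mem_univ i) ?_
  rcases hi with hi | hi <;> rw [hi] <;> simp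

/-- Dilating the cube. -/
noncomputable def dil {N : Type} (τ : I) (s : N → I) : N → I :=
  fun i => Set.projIcc 0 1 zero_le_one ((1 + (τ : ℝ)) * s i - τ / 2)

theorem dil_cont {N : Type} : Continuous fun p : I × (N → I) => dil p.1 p.2 := by
  unfold dil
  refine continuous_pi fun i => continuous_projIcc.comp ?_
  fun_prop

theorem dil_zero {N : Type} (s : N → I) : dil 0 s = s := by
  funext i
  unfold dil
  simp

theorem dil_boundary {N : Type} {s : N → I} (τ : I) (h : s ∈ Cube.boundary N) :
    dil τ s ∈ Cube.boundary N := by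
  obtain ⟨i, hi⟩ := h
  refine ⟨i, ?_⟩
  have h0 := τ.2.1
  rcases hi with hi | hi
  · left
    refine Set.projIcc_of_le_left _ ?_
    rw [hi]; simp only [Set.Icc.coe_zero]; linarith
  · right
    refine Set.projIcc_of_right_le _ ?_
    rw [hi]; simp only [Set.Icc.coe_one]; linarith

theorem dil_one {N : Type} [Fintype N] (s : N → I) :
    dil 1 s ∈ Cube.boundary N ∨ bump s = 1 := by
  by_cases h : ∃ i, (s i : ℝ) ≤ 1 / 4 ∨ 3 / 4 ≤ (s i : ℝ)
  · left
    obtain ⟨i, hi⟩ := h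
    refine ⟨i, ?_⟩
    rcases hi with hi | hi
    · left
      refine Set.projIcc_of_le_left _ ?_
      simp only [Set.Icc.coe_one]; linarith
    · right
      refine Set.projIcc_of_right_le _ ?_
      simp only [Set.Icc.coe_one]; linarith
  · right
    push Not at h
    refine Finset.prod_eq_one fun i _ => ?_
    rw [min_eq_left (by linarith [(h i).1]), min_eq_left (by linarith [(h i).2]), mul_one]

theorem based_null {N : Type} [Fintype N] [Nonempty N] {X : Type*} [TopologicalSpace X]
    (hnull : ∀ (Z : Type) [TopologicalSpace Z] [CompactSpace Z] (γ : C(Z, X)), γ.Nullhomotopic)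
    {x : X} (γ : GenLoop N X x) : GenLoop.Homotopic γ GenLoop.const := by
  let R : (N → I) → (N → I) → Prop := fun a b => a ∈ Cube.boundary N ∧ b ∈ Cube.boundary N
  let γ' : C(Quot R, X) := ⟨Quot.lift γ (fun a b h => (γ.2 a h.1).trans (γ.2 b h.2).symm),
    continuous_quot_lift _ γ.1.continuous⟩
  obtain ⟨y, ⟨H⟩⟩ := hnull (Quot R) γ'
  let b0 : N → I := fun _ => 0
  have hb0 : b0 ∈ Cube.boundary N := ⟨Classical.arbitrary N, Or.inl rfl⟩
  let K : I × (N → I) → X := fun p => H (p.1, Quot.mk R p.2)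
  have hK : Continuous K := H.continuous.comp
    (continuous_fst.prodMk (continuous_quot_mk.comp continuous_snd))
  have K0 : ∀ s, K (0, s) = γ s := fun s => H.apply_zero _
  have K1 : ∀ s, K (1, s) = y := fun s => H.apply_one _
  have Kb : ∀ τ, ∀ b ∈ Cube.boundary N, K (τ, b) = K (τ, b0) := fun τ b hb =>
    congrArg (fun z => H (τ, z)) (Quot.sound (⟨hb, hb0⟩ : R b b0))
  have Kbx : ∀ b ∈ Cube.boundary N, K (0, b) = x := fun b hb => (K0 b).trans (γ.2 b hb)
  let bI : (N → I) → I := fun s => ⟨bump s, bump_mem s⟩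
  have hbI : Continuous bI := Continuous.subtype_mk bump_cont _
  have bI0 : ∀ s ∈ Cube.boundary N, bI s = 0 := fun s hs => Subtype.ext (bump_boundary hs)
  let mid : GenLoop N X x := ⟨⟨fun s => K (bI s, b0), by fun_prop⟩, fun s hs => by
    show K (bI s, b0) = x
    rw [bI0 s hs, Kbx b0 hb0]⟩
  have h1 : GenLoop.Homotopic γ mid := by
    refine ⟨⟨⟨⟨fun p => K (min p.1 (bI p.2), dil p.1 p.2), ?_⟩, ?_, ?_⟩, ?_⟩⟩
    · exact hK.comp ((continuous_fst.min (hbI.comp continuous_snd)).prodMk dil_cont)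
    · intro s
      show K (min 0 (bI s), dil 0 s) = γ s
      rw [dil_zero, min_eq_left (show (0 : I) ≤ bI s from (bI s).2.1), K0]
    · intro s
      show K (min 1 (bI s), dil 1 s) = K (bI s, b0)
      rw [min_eq_right (show bI s ≤ 1 from (bI s).2.2)]
      rcases dil_one s with h | h
      · exact Kb _ _ h
      · have : bI s = 1 := Subtype.ext h
        rw [this, K1, K1]
    · intro τ s hs
      show K (min τ (bI s), dil τ s) = γ s
      rw [bI0 s hs, min_eq_right (show (0 : I) ≤ τ from τ.2.1), Kbx _ (dil_boundary τ hs)]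
      exact (γ.2 s hs).symm
  have h2 : GenLoop.Homotopic mid GenLoop.const := by
    refine ⟨⟨⟨⟨fun p => K (unitInterval.symm p.1 * bI p.2, b0), ?_⟩, ?_, ?_⟩, ?_⟩⟩
    · fun_prop
    · intro s
      show K (unitInterval.symm 0 * bI s, b0) = K (bI s, b0)
      simp
    · intro s
      show K (unitInterval.symm 1 * bI s, b0) = x
      simp only [unitInterval.symm_one, zero_mul]
      exact Kbx _ hb0
    · intro τ s hs
      show K (unitInterval.symm τ * bI s, b0) = K (bI s, b0)
      rw [bI0 s hs, mul_zero]
  exact h1.trans h2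

theorem EE_pathConnected : PathConnectedSpace (EE Call) where
  nonempty := ⟨qt (C := Call) (n := 0) (ψ := 1) InV.one (CFset_std 1)⟩
  joined a b := by
    obtain ⟨y, ⟨H⟩⟩ := null_all (Z := Bool) ⟨fun z => cond z a b, continuous_of_discreteTopology⟩
    have h : ∀ z : Bool, Joined (cond z a b) y := fun z =>
      ⟨⟨⟨fun τ => H (τ, z), by fun_prop⟩, H.apply_zero z, H.apply_one z⟩⟩
    exact (h true).trans (h false).symm

instance EE_simplyConnected : SimplyConnectedSpace (EE Call) := by
  refine simply_connected_iff_loops_nullhomotopic.2 ⟨EE_pathConnected, fun x γ => ?_⟩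
  have h := based_null (N := Fin 1) (X := EE Call) (fun Z _ _ γ => null_all γ)
    ((genLoopEquivOfUnique (Fin 1)).symm γ)
  obtain ⟨H⟩ := h
  refine ⟨⟨⟨⟨fun p => H (p.1, fun _ => p.2), by fun_prop⟩, ?_, ?_⟩, ?_⟩⟩
  · intro t; exact H.apply_zero _
  · intro t; exact H.apply_one _
  · intro τ t ht
    exact H.prop' τ (fun _ => t) ⟨0, ht⟩

theorem boundary_preconnected {k : ℕ} (hk : 2 ≤ k) : IsPreconnected (Cube.boundary (Fin k)) := by
  refine isPreconnected_of_forall (fun _ => (0 : I)) ?_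
  intro y hy
  obtain ⟨i, hi⟩ := hy
  -- first move all other coordinates to zero, then the remaining one
  have hpc : IsPreconnected (Set.univ : Set I) := isPreconnected_univ
  obtain ⟨j, hj⟩ : ∃ j : Fin k, j ≠ i := by
    have : Nontrivial (Fin k) := Fin.nontrivial_iff_two_le.2 hk
    exact exists_ne i
  let f1 : I → (Fin k → I) := fun τ l => if l = i then y i else τ * y l
  let f2 : I → (Fin k → I) := fun τ l => if l = i then τ * y i else 0
  have hf1 : Continuous f1 := by
    refine continuous_pi fun l => ?_
    simp only [f1]
    split_ifs <;> fun_prop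
  have hf2 : Continuous f2 := by
    refine continuous_pi fun l => ?_
    simp only [f2]
    split_ifs <;> fun_prop
  refine ⟨f1 '' Set.univ ∪ f2 '' Set.univ, ?_, ?_, ?_, ?_⟩
  · rintro _ (⟨τ, -, rfl⟩ | ⟨τ, -, rfl⟩)
    · exact ⟨i, by simpa [f1] using hi⟩
    · exact ⟨j, by simp [f2, hj]⟩
  · right
    refine ⟨0, trivial, ?_⟩
    funext l; simp [f2]
  · left
    refine ⟨1, trivial, ?_⟩
    funext l; simp only [f1]; split_ifs with h
    · rw [h]
    · simp
  · refine IsPreconnected.union (f1 0) ⟨0, trivial, rfl⟩ ⟨1, trivial, ?_⟩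
      (hpc.image _ hf1.continuousOn) (hpc.image _ hf2.continuousOn)
    funext l; simp [f1, f2]

theorem CF_higher (k : ℕ) (hk : 2 ≤ k) (x : CF) : Subsingleton (HomotopyGroup (Fin k) CF x) := by
  have cov := isQuotientCoveringMap_pE.isCoveringMap
  suffices h : ∀ γ : GenLoop (Fin k) CF x, GenLoop.Homotopic γ GenLoop.const by
    refine ⟨fun a b => ?_⟩
    induction a using Quotient.ind
    induction b using Quotient.ind
    exact Quotient.sound ((h _).trans (h _).symm)
  intro γ
  have : Nonempty (Fin k) := ⟨⟨0, by omega⟩⟩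
  have hb0 : (fun _ => 0 : Fin k → I) ∈ Cube.boundary (Fin k) := ⟨⟨0, by omega⟩, Or.inl rfl⟩
  obtain ⟨e, he⟩ := isQuotientMap_pE.surjective x
  let G : C(I × (Fin k → I), CF) := ⟨fun p => γ fun i => p.1 * p.2 i,
    γ.1.continuous.comp (by fun_prop)⟩
  have hG0 : ∀ s, G (0, s) = pE (ContinuousMap.const _ e s) := fun s => by
    show γ (fun i => 0 * s i) = pE e
    simp only [zero_mul]
    exact (γ.2 _ hb0).trans he.symm
  let L := cov.liftHomotopy G (ContinuousMap.const _ e) hG0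
  have hL : ∀ p, pE (L p) = G p := fun p => congrFun (cov.liftHomotopy_lifts G _ hG0) p
  let F : C(Fin k → I, EE Call) := ⟨fun s => L (1, s), by fun_prop⟩
  have hF' : ∀ s, pE (F s) = γ s := fun s => by
    refine (hL (1, s)).trans ?_
    show γ (fun i => 1 * s i) = γ s
    simp only [one_mul]
  let Γ : GenLoop (Fin k) (EE Call) (F fun _ => 0) := ⟨F, fun s hs => by
    refine cov.constOn_of_comp (boundary_preconnected hk) F.continuous.continuousOn ?_ hs hb0
    intro a ha b hb
    rw [hF', hF']
    exact (γ.2 a ha).trans (γ.2 b hb).symm⟩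
  obtain ⟨H⟩ := based_null (fun Z _ _ γ => null_all γ) Γ
  refine ⟨⟨⟨⟨fun p => pE (H p), continuous_pE.comp H.continuous⟩, ?_, ?_⟩, ?_⟩⟩
  · intro s
    exact (congrArg pE (H.apply_zero s)).trans (hF' s)
  · intro s
    exact (congrArg pE (H.apply_one s)).trans ((hF' _).trans (γ.2 _ hb0))
  · intro τ s hs
    exact (congrArg pE (H.prop' τ s hs)).trans (hF' s)

theorem CF_pathConnected : PathConnectedSpace CF := by
  have := EE_pathConnected
  exact isQuotientMap_pE.surjective.pathConnectedSpace continuous_pE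

end

section

open Filter Topology unitInterval

/-! ### Identification with Thompson's group -/

theorem FF_maps {f : OI} (hf : f ∈ FF) (y : unitI) : f y ∈ Set.Icc (0 : ℝ) 1 := by
  have h : InV 1 f := hf
  constructor
  · have := f.monotone y.2.1
    rwa [h.left 0 le_rfl] at this
  · have := f.monotone y.2.2
    rw [h.right 1 (by simp)] at this
    push_cast at this
    linarith

/-- Restriction to the unit interval. -/
noncomputable def resF (f : FF) : unitI ≃ₜ unitI where
  toFun y := ⟨f.1 y, FF_maps f.2 y⟩
  invFun y := ⟨f.1⁻¹ y, FF_maps (FF.inv_mem f.2) y⟩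
  left_inv y := Subtype.ext (RelIso.inv_apply_self f.1 y)
  right_inv y := Subtype.ext (RelIso.apply_inv_self f.1 y)
  continuous_toFun := Continuous.subtype_mk
    ((OrderIso.continuous (f.1 : ℝ ≃o ℝ)).comp continuous_subtype_val) _
  continuous_invFun := Continuous.subtype_mk
    ((OrderIso.continuous (f.1⁻¹ : ℝ ≃o ℝ)).comp continuous_subtype_val) _

/-- Restriction to the unit interval, as a homomorphism. -/
noncomputable def resHom : FF →* (unitI ≃ₜ unitI) where
  toFun := resF
  map_one' := Homeomorph.ext fun _ => rfl
  map_mul' _ _ := Homeomorph.ext fun _ => rfl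

theorem resHom_injective : Function.Injective resHom := by
  intro f g h
  have hf : InV 1 f.1 := f.2
  have hg : InV 1 g.1 := g.2
  refine Subtype.ext (RelIso.ext fun x => ?_)
  rcases le_total x 0 with h0 | h0
  · rw [hf.left x h0, hg.left x h0]
  · rcases le_total x 1 with h1 | h1
    · have := congrArg (fun k : unitI ≃ₜ unitI => ((k ⟨x, h0, h1⟩ : unitI) : ℝ)) h
      exact this
    · rw [hf.right x (by simpa using h1), hg.right x (by simpa using h1)]

theorem thompson_of_FF (f : FF) : IsThompsonF (resHom f) := by
  obtain ⟨M, hM⟩ := (show InV 1 f.1 from f.2).std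
  have hpos : (0 : ℝ) < 2 ^ M := by positivity
  refine ⟨2 ^ M, fun j => (j : ℕ) / 2 ^ M, by simp, ?_, ?_, ?_, ?_⟩
  · simp
  · intro a b hab
    simp only
    rw [div_lt_div_iff_of_pos_right hpos]
    exact_mod_cast hab
  · intro j
    exact ⟨j, M, rfl⟩
  · intro j
    obtain ⟨b, k, -, hk⟩ := hM ((j : ℕ) : ℤ)
    refine ⟨(M : ℤ) - k, (b - (j : ℕ)) / 2 ^ k, fun y h1 h2 => ?_⟩
    simp only [Fin.val_castSucc, Fin.val_succ] at h1 h2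
    rw [div_le_iff₀ hpos] at h1
    rw [le_div_iff₀ hpos] at h2
    push_cast at h2
    have h3 := hk (2 ^ M * y - (j : ℕ)) (by linarith) (by linarith)
    have e : (((((j : ℕ) : ℤ)) : ℝ) + (2 ^ M * y - (j : ℕ))) / 2 ^ M = (y : ℝ) := by
      push_cast
      field_simp
      ring
    rw [e] at h3
    show f.1 y = _
    rw [h3, zpow_sub₀ two_ne_zero, zpow_natCast, zpow_natCast]
    field_simp
    ring

/-- Dyadic numbers, in a form convenient for taking common denominators. -/
def DE (x : ℝ) : Prop := ∀ᶠ M : ℕ in atTop, ∃ a : ℤ, 2 ^ M * x = a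

theorem IsDyadic.de {x : ℝ} (h : IsDyadic x) : DE x := by
  obtain ⟨a, b, rfl⟩ := h
  filter_upwards [eventually_ge_atTop b] with M hM
  obtain ⟨d, rfl⟩ := Nat.exists_eq_add_of_le hM
  refine ⟨2 ^ d * a, ?_⟩
  push_cast
  rw [pow_add]
  field_simp

theorem DE.dyadic {x : ℝ} (h : DE x) (hx : 0 ≤ x) : IsDyadic x := by
  obtain ⟨M, a, ha⟩ := h.exists
  have h0 : (0 : ℝ) ≤ a := by rw [← ha]; positivity
  have h0 : 0 ≤ a := by exact_mod_cast h0
  lift a to ℕ using h0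
  refine ⟨a, M, ?_⟩
  rw [eq_div_iff (by positivity), mul_comm]
  exact_mod_cast ha

theorem DE.sub {x y : ℝ} (hx : DE x) (hy : DE y) : DE (x - y) := by
  filter_upwards [hx, hy] with M ⟨a, ha⟩ ⟨b, hb⟩
  refine ⟨a - b, ?_⟩
  push_cast
  rw [mul_sub, ha, hb]

theorem DE.add {x y : ℝ} (hx : DE x) (hy : DE y) : DE (x + y) := by
  filter_upwards [hx, hy] with M ⟨a, ha⟩ ⟨b, hb⟩
  refine ⟨a + b, ?_⟩
  push_cast
  rw [mul_add, ha, hb]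

theorem DE.shift {x : ℝ} (hx : DE x) (m : ℤ) :
    ∀ᶠ M : ℕ in atTop, ∃ a : ℤ, (2 : ℝ) ^ ((M : ℤ) + m) * x = a := by
  obtain ⟨N, hN⟩ := eventually_atTop.1 hx
  filter_upwards [eventually_ge_atTop (N + m.natAbs)] with M hM
  obtain ⟨d, hd⟩ : ∃ d : ℕ, (M : ℤ) + m = d := ⟨((M : ℤ) + m).toNat, by omega⟩
  rw [hd, zpow_natCast]
  exact hN d (by omega)

theorem DE.zpow_mul {x : ℝ} (hx : DE x) (m : ℤ) : DE (2 ^ m * x) := by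
  filter_upwards [hx.shift m] with M ⟨a, ha⟩
  refine ⟨a, ?_⟩
  rw [← ha, zpow_add₀ two_ne_zero, zpow_natCast, mul_assoc]

theorem find_piece {k : ℕ} (x : Fin (k + 1) → ℝ) {z : ℝ} (h0 : x 0 ≤ z) (h1 : z < x (Fin.last k)) :
    ∃ j : Fin k, x j.castSucc ≤ z ∧ z < x j.succ := by
  by_contra h
  push Not at h
  have : ∀ j : Fin (k + 1), x j ≤ z := by
    intro j
    induction j using Fin.induction with
    | zero => exact h0
    | succ i ih => exact h i ih
  exact absurd (this (Fin.last k)) (not_le.2 h1)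

theorem thompson_strictMono {f : unitI ≃ₜ unitI} (hf : IsThompsonF f) : StrictMono f := by
  rcases Continuous.strictMono_of_inj_boundedOrder' f.continuous f.injective with h | h
  · exact h
  · exfalso
    obtain ⟨k, x, h0, h1, hx, -, hj⟩ := hf
    obtain ⟨j, hj0, hj1⟩ := find_piece x (z := 0) h0.le (by rw [h1]; exact zero_lt_one)
    have hle : x j.succ ≤ 1 := by rw [← h1]; exact hx.monotone (Fin.le_last _)
    obtain ⟨m, c, hc⟩ := hj j
    have e0 := hc ⟨0, le_rfl, zero_le_one⟩ hj0 hj1.le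
    have e1 := hc ⟨x j.succ, hj1.le, hle⟩ (hj0.trans hj1.le) le_rfl
    have := h (show (⟨0, le_rfl, zero_le_one⟩ : unitI) < ⟨x j.succ, hj1.le, hle⟩ from hj1)
    have h3 : ((f ⟨x j.succ, hj1.le, hle⟩ : unitI) : ℝ) < (f ⟨0, le_rfl, zero_le_one⟩ : unitI) := this
    rw [e0, e1] at h3
    have h4 : (0 : ℝ) < 2 ^ m * x j.succ := mul_pos (by positivity) hj1
    simp only [mul_zero] at h3
    linarith

theorem strictMono_fix {f : unitI ≃ₜ unitI} (hf : StrictMono f) : f 0 = 0 ∧ f 1 = 1 := by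
  constructor
  · refine le_antisymm ?_ (f 0).2.1
    have := hf.monotone (show (0 : unitI) ≤ f.symm 0 from (f.symm 0).2.1)
    rwa [f.apply_symm_apply] at this
  · refine le_antisymm (f 1).2.2 ?_
    have := hf.monotone (show f.symm 1 ≤ (1 : unitI) from (f.symm 1).2.2)
    rwa [f.apply_symm_apply] at this

theorem thompson_piece {f : unitI ≃ₜ unitI} (hf : IsThompsonF f) :
    ∃ (k : ℕ) (x : Fin (k + 1) → ℝ) (hx : ∀ j, x j ∈ Set.Icc (0 : ℝ) 1),
      x 0 = 0 ∧ x (Fin.last k) = 1 ∧ StrictMono x ∧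
      (∀ j, IsDyadic (x j)) ∧ (∀ j, DE (f ⟨x j, hx j⟩ : unitI)) ∧
      ∀ j : Fin k, ∃ (m : ℤ) (c : ℝ), DE c ∧ ∀ y : unitI,
        x j.castSucc ≤ (y : ℝ) → (y : ℝ) ≤ x j.succ → ((f y : ℝ)) = 2 ^ m * (y : ℝ) + c := by
  have hmono := thompson_strictMono hf
  obtain ⟨k, x, h0, h1, hx, hd, hj⟩ := hf
  have hmem : ∀ j, x j ∈ Set.Icc (0 : ℝ) 1 := fun j =>
    ⟨by rw [← h0]; exact hx.monotone (Fin.zero_le _), by rw [← h1]; exact hx.monotone (Fin.le_last _)⟩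
  have hlt : ∀ j : Fin k, x j.castSucc ≤ x j.succ := fun j => (hx Fin.castSucc_lt_succ).le
  have step : ∀ j : Fin k, DE (f ⟨x j.castSucc, hmem _⟩ : unitI) → ∀ (m : ℤ) (c : ℝ),
      (∀ y : unitI, x j.castSucc ≤ (y : ℝ) → (y : ℝ) ≤ x j.succ → ((f y : ℝ)) = 2 ^ m * (y : ℝ) + c) →
      DE c := by
    intro j hj m c hc
    have e := hc ⟨x j.castSucc, hmem _⟩ le_rfl (hlt j)
    have : c = (f ⟨x j.castSucc, hmem _⟩ : unitI) - 2 ^ m * x j.castSucc := by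
      rw [e]; ring
    rw [this]
    exact hj.sub ((hd _).de.zpow_mul m)
  have hfd : ∀ j, DE (f ⟨x j, hmem j⟩ : unitI) := by
    intro j
    induction j using Fin.induction with
    | zero =>
      have : (⟨x 0, hmem 0⟩ : unitI) = 0 := Subtype.ext h0
      rw [this, (strictMono_fix hmono).1]
      exact IsDyadic.de ⟨0, 0, by simp⟩
    | succ i ih =>
      obtain ⟨m, c, hc⟩ := hj i
      have hc0 := step i ih m c hc
      rw [hc ⟨x i.succ, hmem _⟩ (hlt i) le_rfl]
      exact ((hd _).de.zpow_mul m).add hc0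
  refine ⟨k, x, hmem, h0, h1, hx, hd, hfd, fun j => ?_⟩
  obtain ⟨m, c, hc⟩ := hj j
  exact ⟨m, c, step j (hfd _) m c hc, hc⟩

theorem thompson_symm {f : unitI ≃ₜ unitI} (hf : IsThompsonF f) : IsThompsonF f.symm := by
  have hmono := thompson_strictMono hf
  have hfix := strictMono_fix hmono
  obtain ⟨k, x, hm, h0, h1, hx, hd, hfd, hj⟩ := thompson_piece hf
  refine ⟨k, fun j => (f ⟨x j, hm j⟩ : unitI), ?_, ?_, ?_, ?_, ?_⟩
  · have : (⟨x 0, hm 0⟩ : unitI) = 0 := Subtype.ext h0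
    simp only [this, hfix.1]; rfl
  · have : (⟨x (Fin.last k), hm _⟩ : unitI) = 1 := Subtype.ext h1
    simp only [this, hfix.2]; rfl
  · intro a b hab
    exact hmono (show (⟨x a, hm a⟩ : unitI) < ⟨x b, hm b⟩ from hx hab)
  · intro j
    exact (hfd j).dyadic (f ⟨x j, hm j⟩).2.1
  · intro j
    obtain ⟨m, c, -, hc⟩ := hj j
    refine ⟨-m, -(2 ^ (-m) * c), fun y hy1 hy2 => ?_⟩
    have k1 : (⟨x j.castSucc, hm _⟩ : unitI) ≤ f.symm y := by
      rw [← hmono.le_iff_le, f.apply_symm_apply]; exact hy1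
    have k2 : f.symm y ≤ (⟨x j.succ, hm _⟩ : unitI) := by
      rw [← hmono.le_iff_le, f.apply_symm_apply]; exact hy2
    have e := hc (f.symm y) k1 k2
    rw [f.apply_symm_apply] at e
    rw [e, zpow_neg]
    have : (2 : ℝ) ^ m ≠ 0 := by positivity
    field_simp
    ring

/-- Extension by the identity. -/
noncomputable def extF (f : unitI ≃ₜ unitI) (x : ℝ) : ℝ :=
  (f (Set.projIcc 0 1 zero_le_one x) : unitI) + (x - (Set.projIcc 0 1 zero_le_one x : unitI))

theorem extF_left {f : unitI ≃ₜ unitI} (hf : StrictMono f) {x : ℝ} (hx : x ≤ 0) : extF f x = x := by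
  unfold extF
  rw [Set.projIcc_of_le_left _ hx]
  have : f ⟨0, Set.left_mem_Icc.2 zero_le_one⟩ = 0 := (strictMono_fix hf).1
  rw [this]
  simp

theorem extF_right {f : unitI ≃ₜ unitI} (hf : StrictMono f) {x : ℝ} (hx : 1 ≤ x) :
    extF f x = x := by
  unfold extF
  rw [Set.projIcc_of_right_le _ hx]
  have : f ⟨1, Set.right_mem_Icc.2 zero_le_one⟩ = 1 := (strictMono_fix hf).2
  rw [this]
  simp

theorem extF_mid (f : unitI ≃ₜ unitI) (y : unitI) : extF f y = (f y : unitI) := by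
  unfold extF
  rw [Set.projIcc_val]
  ring

theorem extF_strictMono {f : unitI ≃ₜ unitI} (hf : StrictMono f) : StrictMono (extF f) := by
  intro x y hxy
  have h1 : Set.projIcc (0 : ℝ) 1 zero_le_one x ≤ Set.projIcc 0 1 zero_le_one y :=
    Set.monotone_projIcc _ hxy.le
  unfold extF
  rcases h1.eq_or_lt with h | h
  · rw [h]; linarith
  · have h2 : ((f (Set.projIcc 0 1 zero_le_one x) : unitI) : ℝ) < (f (Set.projIcc 0 1 zero_le_one y) : unitI) :=
      hf h
    have h3 : x - (Set.projIcc 0 1 zero_le_one x : unitI) ≤ y - (Set.projIcc 0 1 zero_le_one y : unitI) := by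
      simp only [Set.coe_projIcc]
      rcases le_total x 0 with a | a <;> rcases le_total x 1 with b | b <;>
        rcases le_total y 0 with c | c <;> rcases le_total y 1 with d | d <;>
        simp [a, b, c, d] <;> linarith
    linarith

theorem extF_inv {f g : unitI ≃ₜ unitI} (hf : StrictMono f) (hg : StrictMono g)
    (h : ∀ y, f (g y) = y) (x : ℝ) : extF f (extF g x) = x := by
  rcases le_total x 0 with h0 | h0
  · rw [extF_left hg h0, extF_left hf h0]
  · rcases le_total x 1 with h1 | h1
    · have e := extF_mid g ⟨x, h0, h1⟩
      simp only at e
      rw [e, extF_mid, h]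
    · rw [extF_right hg h1, extF_right hf h1]

/-- Extension by the identity, as an order isomorphism. -/
noncomputable def extO (f : unitI ≃ₜ unitI) (hf : IsThompsonF f) : OI where
  toFun := extF f
  invFun := extF f.symm
  left_inv := extF_inv (thompson_strictMono (thompson_symm hf)) (thompson_strictMono hf)
    f.symm_apply_apply
  right_inv := extF_inv (thompson_strictMono hf) (thompson_strictMono (thompson_symm hf))
    f.apply_symm_apply
  map_rel_iff' := (extF_strictMono (thompson_strictMono hf)).le_iff_le

theorem extO_inv (f : unitI ≃ₜ unitI) (hf : IsThompsonF f) :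
    (extO f hf)⁻¹ = extO f.symm (thompson_symm hf) := RelIso.ext fun _ => rfl

theorem extO_std (f : unitI ≃ₜ unitI) (hf : IsThompsonF f) : Std (extO f hf) := by
  have hmono := thompson_strictMono hf
  obtain ⟨k, x, hm, h0, h1, hx, hd, -, hj⟩ := thompson_piece hf
  choose m c hc hfc using hj
  have E1 : ∀ᶠ M : ℕ in atTop, ∀ j, ∃ a : ℤ, 2 ^ M * x j = a :=
    eventually_all.2 fun j => (hd j).de
  have E2 : ∀ᶠ M : ℕ in atTop, ∀ j, ∃ a : ℤ, (2 : ℝ) ^ ((M : ℤ) + -m j) * c j = a :=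
    eventually_all.2 fun j => (hc j).shift _
  have E3 : ∀ᶠ M : ℕ in atTop, ∀ j, m j ≤ (M : ℤ) :=
    eventually_all.2 fun j => by
      filter_upwards [eventually_ge_atTop (m j).toNat] with M hM
      omega
  obtain ⟨M, e1, e2, e3⟩ := (E1.and (E2.and E3)).exists
  have hpos : (0 : ℝ) < 2 ^ M := by positivity
  refine ⟨M, fun a => ?_⟩
  show ∃ (b : ℤ) (k : ℕ), 0 ≤ k ∧ ∀ y : ℝ, 0 ≤ y → y ≤ 1 →
    extF f ((a + y) / 2 ^ M) = (b + y) / 2 ^ k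
  rcases lt_or_ge a 0 with ha | ha
  · refine ⟨a, M, Nat.zero_le _, fun y hy0 hy1 => extF_left hmono ?_⟩
    have : (a : ℝ) + 1 ≤ 0 := by exact_mod_cast ha
    exact div_nonpos_of_nonpos_of_nonneg (by linarith) hpos.le
  rcases le_or_gt (2 ^ M) a with ha2 | ha2
  · refine ⟨a, M, Nat.zero_le _, fun y hy0 hy1 => extF_right hmono ?_⟩
    have : (2 : ℝ) ^ M ≤ a := by exact_mod_cast ha2
    rw [le_div_iff₀ hpos]; linarith
  have ha' : (0 : ℝ) ≤ a := by exact_mod_cast ha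
  have ha2' : (a : ℝ) + 1 ≤ 2 ^ M := by exact_mod_cast ha2
  obtain ⟨j, hj0, hj1⟩ := find_piece x (z := a / 2 ^ M) (by rw [h0]; positivity)
    (by rw [h1, div_lt_one hpos]; linarith)
  obtain ⟨q, hq⟩ := e1 j.succ
  have hq' : (a : ℝ) + 1 ≤ 2 ^ M * x j.succ := by
    rw [div_lt_iff₀ hpos, mul_comm, hq] at hj1
    rw [hq]
    have : a < q := by exact_mod_cast hj1
    exact_mod_cast this
  obtain ⟨d, hd⟩ := e2 j
  obtain ⟨k', hk'⟩ : ∃ k' : ℕ, (M : ℤ) + -m j = k' :=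
    ⟨((M : ℤ) + -m j).toNat, by have := e3 j; omega⟩
  refine ⟨a + d, k', Nat.zero_le _, fun y hy0 hy1 => ?_⟩
  have hmem : (a + y) / 2 ^ M ∈ Set.Icc (0 : ℝ) 1 :=
    ⟨by positivity, by rw [div_le_one hpos]; linarith⟩
  have k1 := extF_mid f ⟨(a + y) / 2 ^ M, hmem⟩
  simp only at k1
  rw [k1, hfc j ⟨(a + y) / 2 ^ M, hmem⟩ ?_ ?_]
  · rw [hk', zpow_natCast] at hd
    have hm' : m j = (M : ℤ) - k' := by omega
    have hp' : (2 : ℝ) ^ k' ≠ 0 := by positivity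
    simp only
    rw [hm', zpow_sub₀ two_ne_zero, zpow_natCast, zpow_natCast]
    push_cast
    rw [← hd]
    field_simp
    ring
  · refine hj0.trans ?_
    simp only
    gcongr
    linarith
  · simp only
    rw [div_le_iff₀ hpos, mul_comm]; linarith

theorem extO_mem (f : unitI ≃ₜ unitI) (hf : IsThompsonF f) : extO f hf ∈ FF := by
  show InV 1 (extO f hf)
  refine ⟨extO_std f hf, ?_, fun x hx => extF_left (thompson_strictMono hf) hx, fun x hx => ?_⟩
  · rw [extO_inv]; exact extO_std _ _
  · push_cast at hx ⊢
    refine (extF_right (thompson_strictMono hf) hx).trans ?_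
    ring

theorem resHom_range : (resHom.range : Set (unitI ≃ₜ unitI)) = {f | IsThompsonF f} := by
  ext f
  constructor
  · rintro ⟨g, rfl⟩
    exact thompson_of_FF g
  · intro hf
    refine ⟨⟨extO f hf, extO_mem f hf⟩, Homeomorph.ext fun y => Subtype.ext ?_⟩
    exact extF_mid f y

theorem CF_pi1 : Nonempty (FundamentalGroup CF CFbase ≃* resHom.range) := by
  obtain ⟨e, he⟩ := isQuotientMap_pE.surjective CFbase
  have h1 := isQuotientCoveringMap_pE.fundamentalGroupEquiv (⟨e, he⟩ : pE ⁻¹' {CFbase})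
  exact ⟨(h1.trans (MulEquiv.inv' FF).symm).trans (MonoidHom.ofInjective resHom_injective)⟩

end

/-- Belk's space `CF` is a classifying space for Thompson's group `F`:
it is path-connected, its fundamental group is isomorphic to Thompson's group `F`
(the subgroup of piecewise-linear dyadic homeomorphisms of `[0,1]`), and all
higher homotopy groups vanish. -/
theorem CF_is_classifying_space_for_F :
    PathConnectedSpace CF ∧
    (∃ S : Subgroup (unitI ≃ₜ unitI), (S : Set (unitI ≃ₜ unitI)) = {f | IsThompsonF f} ∧
      Nonempty (FundamentalGroup CF CFbase ≃* S)) ∧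
    (∀ k : ℕ, 2 ≤ k → ∀ x : CF, Subsingleton (HomotopyGroup (Fin k) CF x)) :=
  ⟨CF_pathConnected, ⟨resHom.range, resHom_range, CF_pi1⟩, CF_higher⟩
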